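/- arXiv:math/0612073 — 6 statements merged into one kernel-verified Lean document; each statement's English description precedes it below -/
import Mathlib

section
/- For every integer n ≥ 6, there exists a 3-polytope in ℝ^3 with exactly n vertices whose graph admits a sensitive LP digraph. -/
open Set

/-- `Euc d` is the ambient space `ℝ^d`. -/
abbrev Euc (d : ℕ) : Type := Fin d → ℝ

/-- A `d`-polytope in `ℝ^d`: the convex hull of a finite set of points whose
affine span is all of `ℝ^d`. -/
def IsPolytope (d : ℕ) (P : Set (Euc d)) : Prop :=
  ∃ S : Finset (Euc d),
    P = convexHull ℝ (S : Set (Euc d)) ∧ affineSpan ℝ (S : Set (Euc d)) = ⊤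

/-- The vertices of a polytope are its extreme points. -/
def Vtx {d : ℕ} (P : Set (Euc d)) : Set (Euc d) :=
  Set.extremePoints ℝ P

/-- Two distinct vertices `u, v` of `P` are adjacent if the closed segment
`[u,v]` is a face (extreme subset) of `P`. -/
def PolyAdj {d : ℕ} (P : Set (Euc d)) (u v : Euc d) : Prop :=
  u ≠ v ∧ u ∈ Vtx P ∧ v ∈ Vtx P ∧ IsExtreme ℝ P (segment ℝ u v)

/-- A directed path from `s` to `t` in the digraph `D`: a duplicate-free list of
vertices starting at `s`, ending at `t`, consecutive elements joined by edges. -/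
def IsDipath {α : Type*} (D : α → α → Prop) (s t : α) (p : List α) : Prop :=
  p.Chain' D ∧ p.head? = some s ∧ p.getLast? = some t ∧ p.Nodup

/-- Two `s`-`t` paths are internally disjoint if they share only `s` and `t`. -/
def InternallyDisjoint {α : Type*} (s t : α) (p q : List α) : Prop :=
  ∀ x, x ∈ p → x ∈ q → x = s ∨ x = t

/-- There exist `k` pairwise internally vertex-disjoint directed paths from `s` to `t`. -/
def HKPaths {α : Type*} (D : α → α → Prop) (s t : α) (k : ℕ) : Prop :=
  ∃ paths : Fin k → List α,
    (∀ i, IsDipath D s t (paths i)) ∧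
    ∀ i j, i ≠ j → InternallyDisjoint s t (paths i) (paths j)

/-- A source of a digraph on the node set `V`: no incoming edges. -/
def IsSource {α : Type*} (V : Set α) (D : α → α → Prop) (s : α) : Prop :=
  s ∈ V ∧ ∀ x ∈ V, ¬ D x s

/-- A sink of a digraph on the node set `V`: no outgoing edges. -/
def IsSink {α : Type*} (V : Set α) (D : α → α → Prop) (t : α) : Prop :=
  t ∈ V ∧ ∀ x ∈ V, ¬ D t x

def UniqueSource {α : Type*} (V : Set α) (D : α → α → Prop) (s : α) : Prop :=
  IsSource V D s ∧ ∀ x, IsSource V D x → x = s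

def UniqueSink {α : Type*} (V : Set α) (D : α → α → Prop) (t : α) : Prop :=
  IsSink V D t ∧ ∀ x, IsSink V D x → x = t

/-- A digraph is acyclic if it has no directed cycle. -/
def DigraphAcyclic {α : Type*} (D : α → α → Prop) : Prop :=
  ∀ x, ¬ Relation.TransGen D x x

/-- The digraph obtained from `D` by reversing the single edge `(a, b)`. -/
def ReverseEdge {α : Type*} (D : α → α → Prop) (a b : α) : α → α → Prop :=
  fun u v => (D u v ∧ ¬ (u = a ∧ v = b)) ∨ (u = b ∧ v = a)

/-- A linear functional is generic for `P` if it takes distinct values on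
distinct vertices of `P`. -/
def GenericOn {d : ℕ} (P : Set (Euc d)) (f : Euc d →ₗ[ℝ] ℝ) : Prop :=
  Set.InjOn f (Vtx P)

/-- The LP digraph of `P` induced by `f`: each edge `{u,v}` of the graph of `P`
is directed from `u` to `v` iff `f u < f v`. -/
def LPDigraph {d : ℕ} (P : Set (Euc d)) (f : Euc d →ₗ[ℝ] ℝ) :
    Euc d → Euc d → Prop :=
  fun u v => PolyAdj P u v ∧ f u < f v

/-- `s` is the vertex of `P` with the smallest `f`-value. -/
def IsMinVtx {d : ℕ} (P : Set (Euc d)) (f : Euc d →ₗ[ℝ] ℝ) (s : Euc d) : Prop :=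
  s ∈ Vtx P ∧ ∀ x ∈ Vtx P, x ≠ s → f s < f x

/-- `w` is the vertex of `P` with the second smallest `f`-value
(`s` being the smallest). -/
def IsSecondMinVtx {d : ℕ} (P : Set (Euc d)) (f : Euc d →ₗ[ℝ] ℝ)
    (s w : Euc d) : Prop :=
  w ∈ Vtx P ∧ w ≠ s ∧ ∀ x ∈ Vtx P, x ≠ s → x ≠ w → f w < f x

/-- `t` is the vertex of `P` with the largest `f`-value. -/
def IsMaxVtx {d : ℕ} (P : Set (Euc d)) (f : Euc d →ₗ[ℝ] ℝ) (t : Euc d) : Prop :=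
  t ∈ Vtx P ∧ ∀ x ∈ Vtx P, x ≠ t → f x < f t

/-- A digraph on the node set `V` satisfies the Holt-Klee condition (with
parameter `k`) if it has a unique source `s`, a unique sink `t`, and there are
`k` pairwise internally vertex-disjoint directed paths from `s` to `t`. -/
def SatisfiesHK {α : Type*} (k : ℕ) (V : Set α) (D : α → α → Prop) : Prop :=
  ∃ s t, UniqueSource V D s ∧ UniqueSink V D t ∧ HKPaths D s t k

/-- The marked LP digraph `(P, f, s, w)` (with `f` generic, `s` the `f`-smallest
vertex, `w` the second `f`-smallest vertex, `{s,w}` an edge) is sensitive if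
reversing the orientation of the edge `(s,w)` yields a digraph violating the
Holt-Klee condition. -/
def SensitiveMarkedLP (d : ℕ) (P : Set (Euc d)) (f : Euc d →ₗ[ℝ] ℝ)
    (s w : Euc d) : Prop :=
  GenericOn P f ∧ IsMinVtx P f s ∧ IsSecondMinVtx P f s w ∧ PolyAdj P s w ∧
  ¬ SatisfiesHK d (Vtx P) (ReverseEdge (LPDigraph P f) s w)

/-- A `d`-polytope admits a sensitive LP digraph if there is a generic linear
functional `f` for which the marked LP digraph `(P, f, s, w)` is sensitive. -/
def AdmitsSensitiveLP (d : ℕ) (P : Set (Euc d)) : Prop :=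
  ∃ (f : Euc d →ₗ[ℝ] ℝ) (s w : Euc d), SensitiveMarkedLP d P f s w


/-- If a linear functional equals `c` on `A` and exceeds `c` on `T`, then the convex hull of `A`
is a face of the convex hull of `A ∪ T`. -/
lemma isExtreme_convexHull_union {d : ℕ} {A T : Set (Euc d)} (g : Euc d →ₗ[ℝ] ℝ) (c : ℝ)
    (hA : ∀ x ∈ A, g x = c) (hT : ∀ x ∈ T, c < g x) (hA' : A.Nonempty) (hT' : T.Nonempty) :
    IsExtreme ℝ (convexHull ℝ (A ∪ T)) (convexHull ℝ A) := by
  have hAc : ∀ x ∈ convexHull ℝ A, g x = c := fun x hx =>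
    convexHull_min (t := {x | g x = c}) hA (convex_hyperplane g.isLinear c) hx
  have hTc : ∀ x ∈ convexHull ℝ T, c < g x := fun x hx =>
    convexHull_min (t := {x | c < g x}) hT (convex_halfSpace_gt g.isLinear c) hx
  have key : ∀ x ∈ convexHull ℝ (A ∪ T), c ≤ g x ∧ (g x = c → x ∈ convexHull ℝ A) := by
    intro x hx
    rw [convexHull_union hA' hT', mem_convexJoin] at hx
    obtain ⟨y, hy, z, hz, α, β, hα, hβ, hαβ, rfl⟩ := hx
    have h1 := hAc y hy
    have h2 := hTc z hz
    have h3 : g (α • y + β • z) = c + β * (g z - c) := by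
      simp only [map_add, map_smul, smul_eq_mul, h1]
      linear_combination c * hαβ
    rw [h3]
    refine ⟨by nlinarith, fun h => ?_⟩
    have hβ0 : β = 0 := by
      have : β * (g z - c) = 0 := by linarith
      rcases mul_eq_zero.1 this with h | h
      · exact h
      · linarith
    have hα1 : α = 1 := by linarith
    simpa [hβ0, hα1] using hy
  refine ⟨convexHull_mono subset_union_left, ?_⟩
  rintro x hx y hy z hz ⟨α, β, hα, hβ, hαβ, rfl⟩
  have h := hAc _ hz
  simp only [map_add, map_smul, smul_eq_mul] at h
  obtain ⟨h1, h1'⟩ := key x hx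
  obtain ⟨h2, h2'⟩ := key y hy
  have h3 : α * (g x - c) + β * (g y - c) = 0 := by linear_combination h - c * hαβ
  have h4 : α * (g x - c) = 0 := by
    linarith [mul_nonneg hα.le (sub_nonneg.2 h1), mul_nonneg hβ.le (sub_nonneg.2 h2)]
  exact h1' (sub_eq_zero.1 ((mul_eq_zero.1 h4).resolve_left hα.ne'))

lemma mem_Vtx_of_lt {d : ℕ} {S : Set (Euc d)} {v u : Euc d} (g : Euc d →ₗ[ℝ] ℝ)
    (hv : v ∈ S) (hu : u ∈ S) (huv : u ≠ v) (h : ∀ x ∈ S, x ≠ v → g v < g x) :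
    v ∈ Vtx (convexHull ℝ S) := by
  have h1 := isExtreme_convexHull_union (A := {v}) (T := S \ {v}) g (g v)
    (by simp) (fun x hx => h x hx.1 hx.2) (by simp) ⟨u, hu, huv⟩
  rw [union_sdiff_cancel (by simpa using hv), convexHull_singleton, isExtreme_singleton] at h1
  exact h1

lemma isExtreme_segment_of_lt {d : ℕ} {S : Set (Euc d)} {v w u : Euc d} (g : Euc d →ₗ[ℝ] ℝ)
    (hv : v ∈ S) (hw : w ∈ S) (hu : u ∈ S) (huv : u ≠ v) (huw : u ≠ w) (hvw : g v = g w)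
    (h : ∀ x ∈ S, x ≠ v → x ≠ w → g w < g x) :
    IsExtreme ℝ (convexHull ℝ S) (segment ℝ v w) := by
  have h1 := isExtreme_convexHull_union (A := {v, w}) (T := S \ {v, w}) g (g w)
    (by simp [hvw]) (fun x hx => by
      have := hx.2
      simp only [mem_insert_iff, mem_singleton_iff, not_or] at this
      exact h x hx.1 this.1 this.2) (by simp) ⟨u, hu, by simp [huv, huw]⟩
  rwa [union_sdiff_cancel (by simp [insert_subset_iff, hv, hw]), convexHull_pair] at h1

lemma PolyAdj.eq_of_pos_coeff {d : ℕ} {P : Set (Euc d)} (hP : Convex ℝ P) {u v p q r : Euc d}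
    (h : PolyAdj P u v) (hp : p ∈ Vtx P) (hq : q ∈ P) (hr : r ∈ P) (hpu : p ≠ u)
    {α β γ : ℝ} (hα : 0 < α) (hβ : 0 ≤ β) (hγ : 0 ≤ γ)
    (hv : v - u = α • (p - u) + β • (q - u) + γ • (r - u)) : v = p := by
  obtain ⟨-, hu, hvP, hE⟩ := h
  have hv' : v = u + (α • (p - u) + β • (q - u) + γ • (r - u)) := by rw [← hv]; abel
  have hy : (1 + β + γ)⁻¹ • u + (β / (1 + β + γ)) • q + (γ / (1 + β + γ)) • r ∈ P := by
    have := hP.sum_mem (t := Finset.univ)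
      (w := ![(1 + β + γ)⁻¹, β / (1 + β + γ), γ / (1 + β + γ)]) (z := ![u, q, r])
      (by intro i _; fin_cases i <;> simp <;> positivity)
      (by simp [Fin.sum_univ_three]; field_simp)
      (by intro i _; fin_cases i <;> simp [hu.1, hq, hr])
    simpa [Fin.sum_univ_three] using this
  have hC : 0 < 1 + α + β + γ := by positivity
  have hz : u + (1 + α + β + γ)⁻¹ • (v - u) ∈ segment ℝ u v := by
    refine ⟨1 - (1 + α + β + γ)⁻¹, (1 + α + β + γ)⁻¹, ?_, by positivity, by ring, by module⟩
    rw [sub_nonneg]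
    exact inv_le_one_of_one_le₀ (by linarith)
  have hmem := hE.2 hp.1 hy hz ⟨α / (1 + α + β + γ), (1 + β + γ) / (1 + α + β + γ),
    by positivity, by positivity, by field_simp; ring, by
      rw [hv]
      ext i
      simp
      field_simp
      ring⟩
  rcases (mem_extremePoints_iff_forall_segment.1 hp).2 u hu.1 v hvP.1 hmem with h | h
  · exact absurd h.symm hpu
  · exact h

/-- If all edge directions at `u` lie in the cone spanned by three edges, then `u` has no other
neighbours. -/
lemma PolyAdj.eq_of_mem_cone {d : ℕ} {P : Set (Euc d)} (hP : Convex ℝ P) {u v p q r : Euc d}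
    (h : PolyAdj P u v) (hp : p ∈ Vtx P) (hq : q ∈ Vtx P) (hr : r ∈ Vtx P)
    (hpu : p ≠ u) (hqu : q ≠ u) (hru : r ≠ u)
    {α β γ : ℝ} (hα : 0 ≤ α) (hβ : 0 ≤ β) (hγ : 0 ≤ γ)
    (hv : v - u = α • (p - u) + β • (q - u) + γ • (r - u)) : v = p ∨ v = q ∨ v = r := by
  rcases hα.eq_or_lt with hα0 | hα'
  · rcases hβ.eq_or_lt with hβ0 | hβ'
    · rcases hγ.eq_or_lt with hγ0 | hγ'
      · rw [← hα0, ← hβ0, ← hγ0] at hv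
        simp only [zero_smul, add_zero] at hv
        exact absurd (sub_eq_zero.1 hv).symm h.1
      · exact Or.inr (Or.inr (h.eq_of_pos_coeff hP hr hp.1 hq.1 hru hγ' hα hβ (by rw [hv]; abel)))
    · exact Or.inr (Or.inl (h.eq_of_pos_coeff hP hq hp.1 hr.1 hqu hβ' hα hγ (by rw [hv]; abel)))
  · exact Or.inl (h.eq_of_pos_coeff hP hp hq.1 hr.1 hpu hα' hβ hγ hv)

/-- Two inner vertices meeting every dipath rule out three internally disjoint dipaths. -/
lemma not_HKPaths_of_cut {α : Type*} {D : α → α → Prop} {s t x y : α}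
    (hxs : x ≠ s) (hxt : x ≠ t) (hys : y ≠ s) (hyt : y ≠ t)
    (h : ∀ p, IsDipath D s t p → x ∈ p ∨ y ∈ p) : ¬ HKPaths D s t 3 := by
  rintro ⟨p, hp, hd⟩
  have hx : ∀ i j, i ≠ j → x ∈ p i → x ∉ p j := fun i j hij hi hj => by
    rcases hd i j hij x hi hj with h | h <;> contradiction
  have hy : ∀ i j, i ≠ j → y ∈ p i → y ∉ p j := fun i j hij hi hj => by
    rcases hd i j hij y hi hj with h | h <;> contradiction
  have h0 := h _ (hp 0)
  have h1 := h _ (hp 1)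
  have h2 := h _ (hp 2)
  have := hx 0 1 (by decide)
  have := hx 0 2 (by decide)
  have := hx 1 2 (by decide)
  have := hy 0 1 (by decide)
  have := hy 0 2 (by decide)
  have := hy 1 2 (by decide)
  tauto

lemma IsDipath.mem_or_mem {α : Type*} {D : α → α → Prop} {w t s a b : α} (hwt : w ≠ t)
    (hat : a ≠ t) (hw : ∀ v, D w v → v = s ∨ v = a ∨ v = b) (ha : ∀ v, D a v → v = b)
    {p : List α} (hp : IsDipath D w t p) : s ∈ p ∨ b ∈ p := by
  obtain ⟨hc, hh, hl, -⟩ := hp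
  match p, hc, hh, hl with
  | [_], _, hh, hl =>
    simp only [List.head?_cons, List.getLast?_singleton, Option.some.injEq] at hh hl
    exact absurd (hh.symm.trans hl) hwt
  | [_, v], hc, hh, hl =>
    simp only [List.head?_cons, Option.some.injEq, List.getLast?_cons_cons,
      List.getLast?_singleton] at hh hl
    subst hh hl
    have hwv := (List.isChain_cons_cons.1 hc).1
    rcases hw _ hwv with rfl | rfl | rfl
    · simp
    · exact absurd rfl hat
    · simp
  | _ :: v :: v' :: _, hc, hh, _ =>
    simp only [List.head?_cons, Option.some.injEq] at hh
    subst hh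
    have hc' := List.isChain_cons_cons.1 hc
    rcases hw _ hc'.1 with rfl | rfl | rfl
    · simp
    · simp [ha _ (List.isChain_cons_cons.1 hc'.2).1]
    · simp

/-- Local criterion for sensitivity in dimension three. -/
lemma sensitiveMarkedLP_of_neighbours {P : Set (Euc 3)} {f : Euc 3 →ₗ[ℝ] ℝ} {s w a b t : Euc 3}
    (hf : GenericOn P f) (hs : IsMinVtx P f s) (hw : IsSecondMinVtx P f s w)
    (ht : IsMaxVtx P f t) (hsw : PolyAdj P s w) (haw : a ≠ w) (hbw : b ≠ w) (hst : s ≠ t)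
    (hwt : w ≠ t) (hat : a ≠ t) (hbt : b ≠ t)
    (hwn : ∀ v, PolyAdj P w v → v = s ∨ v = a ∨ v = b)
    (han : ∀ v, PolyAdj P a v → f a < f v → v = b) : SensitiveMarkedLP 3 P f s w := by
  refine ⟨hf, hs, hw, hsw, ?_⟩
  rintro ⟨s', t', ⟨-, hs'⟩, ⟨-, ht'⟩, hHK⟩
  have hws : w = s' := by
    refine hs' w ⟨hw.1, fun x hx => ?_⟩
    rintro (⟨⟨hadj, hlt⟩, hne⟩ | ⟨-, h⟩)
    · have hxs : x ≠ s := fun h => hne ⟨h, rfl⟩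
      exact absurd (hw.2.2 x hx hxs hadj.1) hlt.not_gt
    · exact hw.2.1 h
  have htt : t = t' := by
    refine ht' t ⟨ht.1, fun x hx => ?_⟩
    rintro (⟨⟨hadj, hlt⟩, -⟩ | ⟨h, -⟩)
    · exact absurd (ht.2 x hx hadj.1.symm) hlt.not_gt
    · exact hwt h.symm
  subst hws htt
  refine not_HKPaths_of_cut hw.2.1.symm hst hbw hbt (fun p hp => ?_) hHK
  refine hp.mem_or_mem hwt hat (fun v hv => ?_) (fun v hv => ?_)
  · rcases hv with ⟨⟨h, -⟩, -⟩ | ⟨-, h⟩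
    · exact hwn v h
    · exact Or.inl h
  · rcases hv with ⟨⟨h, h'⟩, -⟩ | ⟨h, -⟩
    · exact han v h h'
    · exact absurd h haw

/-- The linear functional on `ℝ^3` with the given coefficients. -/
noncomputable def coordFunctional (α β γ : ℝ) : Euc 3 →ₗ[ℝ] ℝ :=
  α • LinearMap.proj 0 + β • LinearMap.proj 1 + γ • LinearMap.proj 2

lemma coordFunctional_apply (α β γ x y z : ℝ) :
    coordFunctional α β γ ![x, y, z] = α * x + β * y + γ * z := by
  simp [coordFunctional]

/-- Points on a parabola in the plane `x = 0`. -/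
def parabolaPoint (i : ℕ) : Euc 3 := ![0, i, i * (i - 1)]

lemma parabolaPoint_injective : Function.Injective parabolaPoint := fun i j h => by
  have := congrFun h 1
  simpa [parabolaPoint] using this

/-- The vertices of a polytope generalizing a triangular prism: three points off the
parabola, together with the first `n - 3` parabola points. -/
noncomputable def prismVertices (n : ℕ) : Finset (Euc 3) :=
  insert ![1, 0, 0] (insert ![0, 0, 1] (insert ![1 + (n : ℝ), 1, 0]
    ((Finset.range (n - 3)).image parabolaPoint)))

lemma mem_prismVertices {n : ℕ} {x : Euc 3} :
    x ∈ prismVertices n ↔ x = ![1, 0, 0] ∨ x = ![0, 0, 1] ∨ x = ![1 + (n : ℝ), 1, 0] ∨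
      ∃ i < n - 3, parabolaPoint i = x := by
  simp [prismVertices]

lemma ne_parabolaPoint_of_ne {x y z : ℝ} (h : x ≠ 0) (i : ℕ) :
    ![x, y, z] ≠ parabolaPoint i := fun h' => by
  have := congrFun h' 0
  simp [parabolaPoint] at this
  exact h this

lemma e_three_ne_parabolaPoint (i : ℕ) : ![0, 0, 1] ≠ parabolaPoint i := fun h => by
  have h1 := congrFun h 1
  have h2 := congrFun h 2
  simp [parabolaPoint] at h1 h2
  simp [← h1] at h2

lemma e_one_ne_e_three : (![1, 0, 0] : Euc 3) ≠ ![0, 0, 1] := fun h => by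
  have := congrFun h 0
  simp at this

lemma apex_ne_e_one (n : ℕ) : (![1 + (n : ℝ), 1, 0] : Euc 3) ≠ ![1, 0, 0] := fun h => by
  have := congrFun h 1
  simp at this

lemma apex_ne_e_three (n : ℕ) : (![1 + (n : ℝ), 1, 0] : Euc 3) ≠ ![0, 0, 1] := fun h => by
  have := congrFun h 1
  simp at this

lemma card_prismVertices {n : ℕ} (hn : 6 ≤ n) : (prismVertices n).card = n := by
  have hn0 : (1 + (n : ℝ)) ≠ 0 := by positivity
  rw [prismVertices, Finset.card_insert_of_notMem, Finset.card_insert_of_notMem,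
    Finset.card_insert_of_notMem, Finset.card_image_of_injective _ parabolaPoint_injective,
    Finset.card_range]
  · omega
  · simp only [Finset.mem_image, not_exists, not_and]
    exact fun i _ h => ne_parabolaPoint_of_ne hn0 i h.symm
  · simp only [Finset.mem_insert, Finset.mem_image, not_or, not_exists, not_and]
    exact ⟨(apex_ne_e_three n).symm, fun i _ h => e_three_ne_parabolaPoint i h.symm⟩
  · simp only [Finset.mem_insert, Finset.mem_image, not_or, not_exists, not_and]
    exact ⟨e_one_ne_e_three, (apex_ne_e_one n).symm,
      fun i _ h => ne_parabolaPoint_of_ne one_ne_zero i h.symm⟩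

lemma affineSpan_prismVertices {n : ℕ} (hn : 6 ≤ n) :
    affineSpan ℝ (prismVertices n : Set (Euc 3)) = ⊤ := by
  have h0 : parabolaPoint 0 ∈ (prismVertices n : Set (Euc 3)) :=
    mem_prismVertices.2 (Or.inr (Or.inr (Or.inr ⟨0, by omega, rfl⟩)))
  have h1 : parabolaPoint 1 ∈ (prismVertices n : Set (Euc 3)) :=
    mem_prismVertices.2 (Or.inr (Or.inr (Or.inr ⟨1, by omega, rfl⟩)))
  have hw : ![1, 0, 0] ∈ (prismVertices n : Set (Euc 3)) := mem_prismVertices.2 (by simp)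
  have hb : ![0, 0, 1] ∈ (prismVertices n : Set (Euc 3)) := mem_prismVertices.2 (by simp)
  rw [AffineSubspace.affineSpan_eq_top_iff_vectorSpan_eq_top_of_nonempty ℝ _ _ ⟨_, h0⟩,
    eq_top_iff]
  intro v _
  have hv : v = v 0 • (![1, 0, 0] -ᵥ parabolaPoint 0) + v 1 • (parabolaPoint 1 -ᵥ parabolaPoint 0)
      + v 2 • (![0, 0, 1] -ᵥ parabolaPoint 0) := by
    ext i
    fin_cases i <;> simp [parabolaPoint]
  rw [hv]
  exact Submodule.add_mem _ (Submodule.add_mem _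
    (Submodule.smul_mem _ _ (vsub_mem_vectorSpan ℝ hw h0))
    (Submodule.smul_mem _ _ (vsub_mem_vectorSpan ℝ h1 h0)))
    (Submodule.smul_mem _ _ (vsub_mem_vectorSpan ℝ hb h0))

lemma Vtx_convexHull_prismVertices {n : ℕ} (hn : 6 ≤ n) :
    Vtx (convexHull ℝ (prismVertices n : Set (Euc 3))) = prismVertices n := by
  have hn' : (6 : ℝ) ≤ n := by exact_mod_cast hn
  refine Subset.antisymm extremePoints_convexHull_subset fun v hv => ?_
  have hw : ![1, 0, 0] ∈ (prismVertices n : Set (Euc 3)) := mem_prismVertices.2 (by simp)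
  have hb : ![0, 0, 1] ∈ (prismVertices n : Set (Euc 3)) := mem_prismVertices.2 (by simp)
  rcases mem_prismVertices.1 hv with rfl | rfl | rfl | ⟨i, hi, rfl⟩
  · refine mem_Vtx_of_lt (coordFunctional (-1) (n + 1) 0) hv hb e_one_ne_e_three.symm
      fun x hx hne => ?_
    rcases mem_prismVertices.1 hx with rfl | rfl | rfl | ⟨j, hj, rfl⟩
    · exact absurd rfl hne
    · simp only [coordFunctional_apply]; linarith
    · simp only [coordFunctional_apply]; linarith
    · simp only [parabolaPoint, coordFunctional_apply]
      have : (0 : ℝ) ≤ (n + 1) * j := by positivity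
      linarith
  · refine mem_Vtx_of_lt (coordFunctional 0 n (-1)) hv hw e_one_ne_e_three fun x hx hne => ?_
    rcases mem_prismVertices.1 hx with rfl | rfl | rfl | ⟨j, hj, rfl⟩
    · simp only [coordFunctional_apply]; linarith
    · exact absurd rfl hne
    · simp only [coordFunctional_apply]; linarith
    · simp only [parabolaPoint, coordFunctional_apply]
      have hj' : (j : ℝ) ≤ n := by exact_mod_cast (by omega : j ≤ n)
      have : (0 : ℝ) ≤ j := by positivity
      nlinarith
  · refine mem_Vtx_of_lt (coordFunctional (-1) 0 0) hv hw (apex_ne_e_one n).symm fun x hx hne => ?_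
    rcases mem_prismVertices.1 hx with rfl | rfl | rfl | ⟨j, hj, rfl⟩
    · simp only [coordFunctional_apply]; linarith
    · simp only [coordFunctional_apply]; linarith
    · exact absurd rfl hne
    · simp only [parabolaPoint, coordFunctional_apply]; linarith
  · refine mem_Vtx_of_lt (coordFunctional 1 (-(2 * i - 1)) 1) hv hw
      (ne_parabolaPoint_of_ne one_ne_zero i) fun x hx hne => ?_
    rcases mem_prismVertices.1 hx with rfl | rfl | rfl | ⟨j, hj, rfl⟩
    · simp only [parabolaPoint, coordFunctional_apply]; nlinarith [sq_nonneg (i : ℝ)]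
    · simp only [parabolaPoint, coordFunctional_apply]; nlinarith [sq_nonneg (i : ℝ)]
    · simp only [parabolaPoint, coordFunctional_apply]; nlinarith [sq_nonneg ((i : ℝ) - 1)]
    · simp only [parabolaPoint, coordFunctional_apply]
      have hij : (j : ℝ) - i ≠ 0 := fun h => hne (by
        rw [show j = i by exact_mod_cast sub_eq_zero.1 h])
      have := sq_pos_of_ne_zero hij
      nlinarith

lemma prismVertices_nonneg {n : ℕ} {v : Euc 3} (hv : v ∈ prismVertices n) :
    0 ≤ v 0 ∧ 0 ≤ v 1 ∧ 0 ≤ v 2 ∧ 0 ≤ n * v 1 - v 2 + 1 - v 0 := by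
  rcases mem_prismVertices.1 hv with rfl | rfl | rfl | ⟨j, hj, rfl⟩
  · simp
  · simp
  · simp only [Matrix.cons_val]
    exact ⟨by positivity, by norm_num, le_rfl, by linarith⟩
  · have hj' : (j : ℝ) ≤ n := by exact_mod_cast (by omega : j ≤ n)
    have hj0 : (0 : ℝ) ≤ j := by positivity
    have hj1 : (0 : ℝ) ≤ j * (j - 1) := by
      rcases Nat.eq_zero_or_pos j with rfl | h
      · simp
      · have : (1 : ℝ) ≤ j := by exact_mod_cast h
        exact mul_nonneg hj0 (by linarith)
    refine ⟨by simp [parabolaPoint], by simp [parabolaPoint], by simpa [parabolaPoint] using hj1, ?_⟩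
    simp [parabolaPoint]
    nlinarith

/-- For every integer `n ≥ 6`, there exists a 3-polytope in
`ℝ^3` with exactly `n` vertices whose graph admits a sensitive LP digraph. -/
theorem exists_3polytope_sensitiveLP (n : ℕ) (hn : 6 ≤ n) :
    ∃ P : Set (Euc 3),
      IsPolytope 3 P ∧ (Vtx P).ncard = n ∧ AdmitsSensitiveLP 3 P := by
  have hV := Vtx_convexHull_prismVertices hn
  refine ⟨convexHull ℝ (prismVertices n : Set (Euc 3)),
    ⟨_, rfl, affineSpan_prismVertices hn⟩, ?_, ?_⟩
  · rw [hV, Set.ncard_coe_finset, card_prismVertices hn]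
  have hconv := convex_convexHull ℝ (prismVertices n : Set (Euc 3))
  have hn' : (6 : ℝ) ≤ n := by exact_mod_cast hn
  have mw : ![1, 0, 0] ∈ prismVertices n := mem_prismVertices.2 (by simp)
  have mb : ![0, 0, 1] ∈ prismVertices n := mem_prismVertices.2 (by simp)
  have ms : ![1 + (n : ℝ), 1, 0] ∈ prismVertices n := mem_prismVertices.2 (by simp)
  have mq : ∀ i < n - 3, parabolaPoint i ∈ prismVertices n := fun i hi =>
    mem_prismVertices.2 (Or.inr (Or.inr (Or.inr ⟨i, hi, rfl⟩)))
  have hfq : ∀ i, coordFunctional (-2) (-1) 3 (parabolaPoint i) = 3 * i ^ 2 - 4 * i := fun i => by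
    rw [parabolaPoint, coordFunctional_apply]; ring
  have hq_ge : ∀ i : ℕ, (-1 : ℝ) ≤ 3 * i ^ 2 - 4 * i := fun i => by
    rcases Nat.eq_zero_or_pos i with rfl | h
    · simp
    · have : (1 : ℝ) ≤ i := by exact_mod_cast h
      nlinarith
  have hq_lt : ∀ i j : ℕ, i < j → 2 ≤ j → (3 * i ^ 2 - 4 * i : ℝ) < 3 * j ^ 2 - 4 * j := by
    intro i j hij hj
    have h1 : (i : ℝ) + 1 ≤ j := by exact_mod_cast hij
    have h2 : (2 : ℝ) ≤ j := by exact_mod_cast hj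
    have h3 : (0 : ℝ) ≤ i := by positivity
    nlinarith
  have hq_three : ∀ i : ℕ, (3 * i ^ 2 - 4 * i : ℝ) ≠ 3 := fun i h => by
    rcases lt_or_ge i 2 with h2 | h2
    · interval_cases i <;> norm_num at h
    · have : (2 : ℝ) ≤ i := by exact_mod_cast h2
      nlinarith
  have hq_inj : ∀ i j : ℕ, (3 * i ^ 2 - 4 * i : ℝ) = 3 * j ^ 2 - 4 * j → i = j := by
    intro i j h
    by_contra hne
    rcases lt_or_ge i 2 with hi | hi <;> rcases lt_or_ge j 2 with hj | hj
    · interval_cases i <;> interval_cases j <;> first | exact hne rfl | norm_num at h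
    · exact (hq_lt i j (by omega) hj).ne h
    · exact (hq_lt j i (by omega) hi).ne h.symm
    · rcases Nat.lt_or_gt_of_ne hne with h' | h'
      · exact (hq_lt i j h' hj).ne h
      · exact (hq_lt j i h' hi).ne h.symm
  have ht2 : (2 : ℝ) ≤ (n - 4 : ℕ) := by exact_mod_cast (by omega : 2 ≤ n - 4)
  refine ⟨coordFunctional (-2) (-1) 3, ![1 + (n : ℝ), 1, 0], ![1, 0, 0],
    sensitiveMarkedLP_of_neighbours (a := parabolaPoint 0) (b := ![0, 0, 1])
      (t := parabolaPoint (n - 4)) ?_ ⟨hV.ge ms, ?_⟩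
      ⟨hV.ge mw, (apex_ne_e_one n).symm, ?_⟩ ⟨hV.ge (mq _ (by omega)), ?_⟩
      ⟨apex_ne_e_one n, hV.ge ms, hV.ge mw, ?_⟩ (ne_parabolaPoint_of_ne one_ne_zero 0).symm
      e_one_ne_e_three.symm (ne_parabolaPoint_of_ne (by positivity) _)
      (ne_parabolaPoint_of_ne one_ne_zero _) (parabolaPoint_injective.ne (by omega))
      (e_three_ne_parabolaPoint _) ?_ ?_⟩
  · rw [GenericOn, hV]
    intro x hx y hy hxy
    rcases mem_prismVertices.1 hx with rfl | rfl | rfl | ⟨i, hi, rfl⟩ <;>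
      rcases mem_prismVertices.1 hy with rfl | rfl | rfl | ⟨j, hj, rfl⟩ <;>
      simp only [hfq, coordFunctional_apply] at hxy
    all_goals first
      | rfl
      | (exfalso; linarith)
      | (exfalso; linarith [hq_ge i])
      | (exfalso; linarith [hq_ge j])
      | (exact absurd (by linarith) (hq_three i))
      | (exact absurd (by linarith) (hq_three j))
      | rw [hq_inj i j hxy]
  · rw [hV]
    intro x hx hne
    rcases mem_prismVertices.1 hx with rfl | rfl | rfl | ⟨i, hi, rfl⟩
    · simp only [coordFunctional_apply]; linarith
    · simp only [coordFunctional_apply]; linarith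
    · exact absurd rfl hne
    · simp only [hfq, coordFunctional_apply]; linarith [hq_ge i]
  · rw [hV]
    intro x hx hne hne'
    rcases mem_prismVertices.1 hx with rfl | rfl | rfl | ⟨i, hi, rfl⟩
    · exact absurd rfl hne'
    · simp only [coordFunctional_apply]; linarith
    · exact absurd rfl hne
    · simp only [hfq, coordFunctional_apply]; linarith [hq_ge i]
  · rw [hV]
    intro x hx hne
    rcases mem_prismVertices.1 hx with rfl | rfl | rfl | ⟨i, hi, rfl⟩
    · simp only [hfq, coordFunctional_apply]; nlinarith
    · simp only [hfq, coordFunctional_apply]; nlinarith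
    · simp only [hfq, coordFunctional_apply]; nlinarith
    · simp only [hfq]
      have : i ≠ n - 4 := fun h => hne (by rw [h])
      exact hq_lt _ _ (by omega) (by omega)
  · refine isExtreme_segment_of_lt (coordFunctional (-1) n 0) ms mw mb (apex_ne_e_three n).symm
      e_one_ne_e_three.symm (by simp only [coordFunctional_apply]; ring) fun x hx hne hne' => ?_
    rcases mem_prismVertices.1 hx with rfl | rfl | rfl | ⟨i, hi, rfl⟩
    · exact absurd rfl hne'
    · simp only [coordFunctional_apply]; linarith
    · exact absurd rfl hne
    · simp only [parabolaPoint, coordFunctional_apply]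
      have : (0 : ℝ) ≤ n * i := by positivity
      linarith
  · intro v hv
    have hvS : v ∈ prismVertices n := by
      have := hv.2.2.1
      rwa [hV] at this
    obtain ⟨-, h1, h2, h3⟩ := prismVertices_nonneg hvS
    refine hv.eq_of_mem_cone hconv (hV.ge ms) (hV.ge (mq 0 (by omega))) (hV.ge mb) (apex_ne_e_one n)
      (ne_parabolaPoint_of_ne one_ne_zero 0).symm e_one_ne_e_three.symm h1 h3 h2 ?_
    ext i
    fin_cases i <;> simp [parabolaPoint]
    ring
  · intro v hv hlt
    have hvS : v ∈ prismVertices n := by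
      have := hv.2.2.1
      rwa [hV] at this
    obtain ⟨h0, h1, h2, -⟩ := prismVertices_nonneg hvS
    rcases hv.eq_of_mem_cone hconv (hV.ge mw) (hV.ge (mq 1 (by omega))) (hV.ge mb)
      (ne_parabolaPoint_of_ne one_ne_zero 0) (parabolaPoint_injective.ne one_ne_zero)
      (e_three_ne_parabolaPoint 0) h0 h1 h2 (by
        ext i
        fin_cases i <;> simp [parabolaPoint]) with rfl | rfl | rfl
    · simp only [hfq, coordFunctional_apply] at hlt
      norm_num at hlt
    · simp only [hfq] at hlt
      norm_num at hlt
    · rfl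
end

section
/- Let P be a d-polytope in ℝ^d and let v ∈ ℝ^{d+1} be a point whose last coordinate is 1. If P admits a sensitive LP digraph, then the pyramid polytope py(P,v), which is a (d+1)-polytope in ℝ^{d+1}, also admits a sensitive LP digraph. -/
open Set

/-- The pyramid polytope `py(P, v)`: the convex hull of `(P × {0}) ∪ {v}`
in `ℝ^{d+1}`. -/
def Pyramid (d : ℕ) (P : Set (Euc d)) (v : Euc (d + 1)) : Set (Euc (d + 1)) :=
  convexHull ℝ ((fun p : Euc d => (Fin.snoc p 0 : Euc (d + 1))) '' P ∪ {v})

/-- At a vertex `x` of a polytope `P` there is a functional that is positive on `P - x` away from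
`0` and whose level set at height `1` meets every ray from `x` through another point of `P`
inside `P`. -/
theorem exists_vertexFigure_functional {d : ℕ} {P : Set (Euc d)} (hP : IsPolytope d P)
    {x : Euc d} (hx : x ∈ Vtx P) :
    ∃ h : Euc d →L[ℝ] ℝ, ∀ a ∈ P, a ≠ x →
      0 < h (a - x) ∧ x + (h (a - x))⁻¹ • (a - x) ∈ P := by
  obtain ⟨S, rfl, -⟩ := hP
  set P : Set (Euc d) := convexHull ℝ (S : Set (Euc d)) with hPdef
  have hconv : Convex ℝ P := convex_convexHull ℝ _
  have hxS : x ∈ (S : Set (Euc d)) := extremePoints_convexHull_subset hx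
  set R : Set (Euc d) := convexHull ℝ ((S : Set (Euc d)) \ {x}) with hR
  have hRP : R ⊆ P := convexHull_mono sdiff_subset
  have hxR : x ∉ R := fun hmem =>
    (hconv.mem_extremePoints_iff_mem_sdiff_convexHull_sdiff.1 hx).2
      (convexHull_mono (sdiff_subset_sdiff_left (subset_convexHull ℝ _)) hmem)
  have hRclosed : IsClosed R :=
    ((S.finite_toSet.subset sdiff_subset).isCompact_convexHull ℝ).isClosed
  obtain ⟨h, u, hxu, hu⟩ :=
    geometric_hahn_banach_point_closed (convex_convexHull ℝ _) hRclosed hxR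
  have hc : 0 < u - h x := sub_pos.2 hxu
  refine ⟨(u - h x)⁻¹ • h, fun a ha hax => ?_⟩
  have hone : ∀ r ∈ R, 1 ≤ ((u - h x)⁻¹ • h) (r - x) := fun r hr => by
    have := hu r hr
    rw [smul_apply, smul_eq_mul, map_sub, inv_mul_eq_div, le_div_iff₀ hc]
    linarith
  generalize (u - h x)⁻¹ • h = k at hone
  obtain hne | hne := ((S : Set (Euc d)) \ {x}).eq_empty_or_nonempty
  · have : P ⊆ {x} := by
      rw [← convexHull_singleton (𝕜 := ℝ) x]
      exact convexHull_mono (sdiff_eq_empty.1 hne)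
    exact absurd (this ha) hax
  have ha' := ha
  rw [hPdef, ← insert_eq_of_mem hxS, ← insert_sdiff_singleton, convexHull_insert hne,
    mem_convexJoin] at ha'
  obtain ⟨x', rfl, r, hr, har⟩ := ha'
  obtain ⟨θ, ⟨hθ0, -⟩, rfl⟩ := (segment_eq_image' ℝ x' r) ▸ har
  have hθ : 0 < θ := hθ0.lt_of_ne (by rintro rfl; simp at hax)
  have hk := hone r hr
  have hk0 : 0 < k (r - x') := by linarith
  have e : x' + θ • (r - x') - x' = θ • (r - x') := by abel
  rw [e, map_smul, smul_eq_mul]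
  refine ⟨mul_pos hθ hk0, ?_⟩
  rw [smul_smul, mul_inv, mul_right_comm, inv_mul_cancel₀ hθ.ne', one_mul]
  exact hconv.add_smul_sub_mem (subset_convexHull ℝ _ hxS) (hRP hr)
    ⟨by positivity, inv_le_one_of_one_le₀ hk⟩

theorem IsCompact.exists_extremePoint_isMaxOn {d : ℕ} {Q : Set (Euc d)} (hQ : IsCompact Q)
    (hne : Q.Nonempty) (g : Euc d →L[ℝ] ℝ) :
    ∃ q ∈ extremePoints ℝ Q, ∀ z ∈ Q, g z ≤ g q := by
  have h : IsExposed ℝ Q {y ∈ Q | ∀ z ∈ Q, g z ≤ g y} := fun _ => ⟨g, rfl⟩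
  obtain ⟨z, hzQ, hz⟩ := hQ.exists_isMaxOn hne g.continuous.continuousOn
  obtain ⟨q, hq⟩ := (h.isCompact hQ).extremePoints_nonempty ⟨z, hzQ, hz⟩
  exact ⟨q, h.isExtreme.extremePoints_subset_extremePoints hq, hq.1.2⟩

/-- A ray from a vertex `x` through an extreme point `q` of the vertex figure cuts out a face. -/
theorem isExtreme_ray {d : ℕ} {P : Set (Euc d)} {x q : Euc d} {h : Euc d →L[ℝ] ℝ}
    (hxP : x ∈ P)
    (hh : ∀ a ∈ P, a ≠ x → 0 < h (a - x) ∧ x + (h (a - x))⁻¹ • (a - x) ∈ P)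
    (hx : x ∈ Vtx P) (hq : q ∈ extremePoints ℝ {a ∈ P | h (a - x) = 1}) :
    IsExtreme ℝ P {a ∈ P | a - x = h (a - x) • (q - x)} := by
  refine ⟨sep_subset _ _, ?_⟩
  rintro a ha b hb z ⟨hz, hzq⟩ hab
  refine ⟨ha, ?_⟩
  by_cases hax : a = x
  · simp [hax]
  have hzx : z ≠ x := by
    rintro rfl
    exact hax (hx.2 ha hb hab)
  obtain ⟨θ, η, hθ, hη, hsum, rfl⟩ := hab
  have e : θ • a + η • b - x = θ • (a - x) + η • (b - x) := by
    rw [smul_sub, smul_sub, sub_add_sub_comm, ← add_smul, hsum, one_smul]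
  rw [e] at hzq
  rw [map_add, map_smul, map_smul, smul_eq_mul, smul_eq_mul] at hzq
  obtain ⟨hα, haP⟩ := hh a ha hax
  by_cases hbx : b = x
  · subst hbx
    simp only [sub_self, smul_zero, add_zero, map_zero, mul_zero, mul_smul] at hzq
    exact smul_right_injective _ hθ.ne' hzq
  obtain ⟨hβ, hbP⟩ := hh b hb hbx
  set α := h (a - x)
  set β := h (b - x)
  have hm : 0 < θ * α + η * β := by positivity
  have key : x + α⁻¹ • (a - x) = q := by
    refine hq.2 ⟨haP, ?_⟩ (x₂ := x + β⁻¹ • (b - x)) ⟨hbP, ?_⟩ ?_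
    · simp only [add_sub_cancel_left, map_smul, smul_eq_mul]
      exact inv_mul_cancel₀ hα.ne'
    · simp only [add_sub_cancel_left, map_smul, smul_eq_mul]
      exact inv_mul_cancel₀ hβ.ne'
    · refine ⟨θ * α / (θ * α + η * β), η * β / (θ * α + η * β), by positivity, by positivity,
        by field_simp, ?_⟩
      have hq' : q = x + (θ * α + η * β)⁻¹ • (θ • (a - x) + η • (b - x)) := by
        rw [hzq, inv_smul_smul₀ hm.ne', add_sub_cancel]
      rw [hq']
      ext i
      simp only [Pi.add_apply, Pi.smul_apply, Pi.sub_apply, smul_eq_mul]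
      field_simp
      ring
  rw [← key, add_sub_cancel_left, smul_inv_smul₀ hα.ne']

/-- A vertex of a polytope that does not maximise a linear functional has a neighbour on which the
functional is larger. -/
theorem exists_polyAdj_lt {d : ℕ} {P : Set (Euc d)} (hP : IsPolytope d P) {x z : Euc d}
    (hx : x ∈ Vtx P) (hz : z ∈ P) (g : Euc d →ₗ[ℝ] ℝ) (hg : g x < g z) :
    ∃ y, PolyAdj P x y ∧ g x < g y := by
  obtain ⟨h, hh⟩ := exists_vertexFigure_functional hP hx
  obtain ⟨S, hS, -⟩ := hP
  have hconv : Convex ℝ P := hS ▸ convex_convexHull ℝ _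
  have hcomp : IsCompact P := hS ▸ S.finite_toSet.isCompact_convexHull ℝ
  have hxP : x ∈ P := hx.1
  have hQ : IsCompact {a ∈ P | h (a - x) = 1} :=
    hcomp.inter_right (isClosed_eq (by fun_prop) continuous_const)
  obtain ⟨hzpos, hzP⟩ := hh z hz (by rintro rfl; exact hg.false)
  have hzQ : x + (h (z - x))⁻¹ • (z - x) ∈ {a ∈ P | h (a - x) = 1} :=
    ⟨hzP, by simpa only [add_sub_cancel_left, map_smul, smul_eq_mul] using
      inv_mul_cancel₀ hzpos.ne'⟩
  obtain ⟨q, hq, hqmax⟩ :=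
    hQ.exists_extremePoint_isMaxOn ⟨_, hzQ⟩ (LinearMap.toContinuousLinearMap g)
  have hgq : 0 < g (q - x) := by
    have h1 := hqmax _ hzQ
    simp only [LinearMap.coe_toContinuousLinearMap', map_add, map_smul, map_sub,
      smul_eq_mul] at h1 ⊢
    have : 0 < (h z - h x)⁻¹ * (g z - g x) :=
      mul_pos (inv_pos.2 (by simpa using hzpos)) (sub_pos.2 hg)
    linarith
  have hL := isExtreme_ray hxP hh hx hq
  set L : Set (Euc d) := {a ∈ P | a - x = h (a - x) • (q - x)} with hLdef
  have hLcomp : IsCompact L :=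
    hcomp.inter_right (isClosed_eq (by fun_prop) (by fun_prop))
  have hqL : q ∈ L := ⟨hq.1.1, by rw [hq.1.2, one_smul]⟩
  obtain ⟨y, hyL, hy⟩ := hLcomp.exists_isMaxOn ⟨q, hqL⟩ h.continuous.continuousOn
  have hymax : ∀ a ∈ L, h (a - x) ≤ h (y - x) := fun a ha => by
    have : h a ≤ h y := hy ha
    simpa using this
  have hτ : 0 < h (y - x) := by
    have := hymax q hqL
    rw [hq.1.2] at this
    linarith
  have hnonneg : ∀ a ∈ L, 0 ≤ h (a - x) := fun a ha => by
    by_cases hax : a = x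
    · simp [hax]
    · exact (hh a ha.1 hax).1.le
  have hseg : segment ℝ x y = L := by
    refine Subset.antisymm (fun a ha => ⟨hconv.segment_subset hxP hyL.1 ha, ?_⟩) fun a ha => ?_
    · rw [segment_eq_image'] at ha
      obtain ⟨θ, -, rfl⟩ := ha
      simp only [add_sub_cancel_left, map_smul, smul_eq_mul, mul_smul]
      rw [← hyL.2]
    · rw [segment_eq_image']
      refine ⟨h (a - x) / h (y - x), ⟨div_nonneg (hnonneg a ha) hτ.le,
        (div_le_one hτ).2 (hymax a ha)⟩, ?_⟩
      simp only
      have e : h (a - x) / h (y - x) * h (y - x) = h (a - x) := div_mul_cancel₀ _ hτ.ne'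
      calc x + (h (a - x) / h (y - x)) • (y - x)
          = x + (h (a - x) / h (y - x)) • h (y - x) • (q - x) := by rw [← hyL.2]
        _ = a := by rw [smul_smul, e, ← ha.2, add_sub_cancel]
  refine ⟨y, ⟨?_, hx, ⟨hyL.1, ?_⟩, hseg ▸ hL⟩, ?_⟩
  · rintro rfl
    simp at hτ
  · intro a ha b hb hab
    have haL := hL.left_mem_of_mem_openSegment ha hb hyL hab
    have hbL := hL.right_mem_of_mem_openSegment ha hb hyL hab
    obtain ⟨θ, η, hθ, hη, hsum, hyab⟩ := hab
    have e : h (y - x) = θ * h (a - x) + η * h (b - x) := by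
      rw [← hyab]
      simp only [map_sub, map_add, map_smul, smul_eq_mul]
      linear_combination h x * hsum
    have ha1 := hymax a haL
    have hb1 := hymax b hbL
    have hE : h (a - x) = h (y - x) := by
      refine le_antisymm ha1 (not_lt.1 fun hlt => ?_)
      have h1 := mul_lt_mul_of_pos_left hlt hθ
      have h2 := mul_le_mul_of_nonneg_left hb1 hη.le
      have h3 : θ * h (y - x) + η * h (y - x) = h (y - x) := by rw [← add_mul, hsum, one_mul]
      linarith
    have := haL.2.trans (hE ▸ hyL.2.symm)
    exact sub_left_injective this
  · have : g (y - x) = h (y - x) * g (q - x) := by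
      conv_lhs => rw [hyL.2]
      simp
    have h2 : 0 < g (y - x) := this ▸ mul_pos hτ hgq
    simpa using h2

/-- The embedding of `ℝ^d` into `ℝ^{d+1}` as the hyperplane of points with last coordinate `0`. -/
def snocZero (d : ℕ) : Euc d →ₗ[ℝ] Euc (d + 1) where
  toFun p := Fin.snoc p 0
  map_add' p q := by
    ext i
    refine Fin.lastCases ?_ (fun j => ?_) i <;> simp
  map_smul' c p := by
    ext i
    refine Fin.lastCases ?_ (fun j => ?_) i <;> simp

@[simp]
theorem snocZero_last {d : ℕ} (p : Euc d) : snocZero d p (Fin.last d) = 0 := by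
  simp [snocZero]

@[simp]
theorem init_snocZero {d : ℕ} (p : Euc d) : (Fin.init (snocZero d p) : Euc d) = p := by
  simp [snocZero]

theorem snocZero_injective (d : ℕ) : Function.Injective (snocZero d) :=
  Function.LeftInverse.injective (g := fun y : Euc (d + 1) => (Fin.init y : Euc d)) init_snocZero

theorem pyramid_eq (d : ℕ) (P : Set (Euc d)) (v : Euc (d + 1)) :
    Pyramid d P v = convexHull ℝ (snocZero d '' P ∪ {v}) := rfl

theorem IsPolytope.pyramid {d : ℕ} {P : Set (Euc d)} {v : Euc (d + 1)} (hP : IsPolytope d P)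
    (hv : v (Fin.last d) = 1) : IsPolytope (d + 1) (Pyramid d P v) := by
  classical
  obtain ⟨S, rfl, hS⟩ := hP
  refine ⟨insert v (S.image (snocZero d)), ?_, ?_⟩
  · rw [pyramid_eq, LinearMap.image_convexHull, convexHull_convexHull_union_left,
      Finset.coe_insert, Finset.coe_image, union_singleton]
  · set A := affineSpan ℝ (↑(insert v (S.image (snocZero d))) : Set (Euc (d + 1))) with hA
    have hvA : v ∈ A := subset_affineSpan ℝ _ (by simp)
    have hmem : ∀ p, snocZero d p ∈ A := fun p => by
      have hp : p ∈ affineSpan ℝ (S : Set (Euc d)) := hS ▸ AffineSubspace.mem_top ℝ _ p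
      have := AffineSubspace.mem_map_of_mem (snocZero d).toAffineMap hp
      rw [AffineSubspace.map_span] at this
      refine affineSpan_mono ℝ ?_ this
      simp
    refine eq_top_iff.2 fun y _ => ?_
    have := A.smul_vsub_vadd_mem (y (Fin.last d)) hvA (hmem 0)
      (hmem (Fin.init y - y (Fin.last d) • Fin.init v))
    convert this using 1
    ext i
    refine Fin.lastCases ?_ (fun j => ?_) i
    · simp [hv]
    · simp [snocZero, Fin.init]

theorem IsExtreme.image_iff {d e : ℕ} {f : Euc d →ₗ[ℝ] Euc e} (hf : Function.Injective f)
    {A B : Set (Euc d)} : IsExtreme ℝ (f '' A) (f '' B) ↔ IsExtreme ℝ A B := by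
  have key : ∀ a b : Euc d, f '' openSegment ℝ a b = openSegment ℝ (f a) (f b) :=
    image_openSegment ℝ f.toAffineMap
  refine ⟨fun h => ⟨(image_subset_image_iff hf).1 h.1, fun a ha b hb z hz hab => ?_⟩,
    fun h => ⟨image_mono h.1, ?_⟩⟩
  · exact hf.mem_set_image.1 <| h.2 (mem_image_of_mem f ha) (mem_image_of_mem f hb)
      (mem_image_of_mem f hz) (key a b ▸ mem_image_of_mem f hab)
  · rintro _ ⟨a, ha, rfl⟩ _ ⟨b, hb, rfl⟩ _ ⟨z, hz, rfl⟩ hab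
    rw [← key, hf.mem_set_image] at hab
    exact mem_image_of_mem f (h.2 ha hb hz hab)

theorem last_nonneg_of_mem_pyramid {d : ℕ} {P : Set (Euc d)} {v : Euc (d + 1)}
    (hP : Convex ℝ P) (hv : v (Fin.last d) = 1) {y : Euc (d + 1)} (hy : y ∈ Pyramid d P v) :
    0 ≤ y (Fin.last d) ∧ (y (Fin.last d) = 0 → y ∈ snocZero d '' P) := by
  have hconv : Convex ℝ (snocZero d '' P) := hP.linear_image _
  rw [pyramid_eq, union_singleton] at hy
  obtain rfl | hne := P.eq_empty_or_nonempty
  · simp only [image_empty, insert_empty_eq, convexHull_singleton, mem_singleton_iff] at hy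
    subst hy
    simp [hv]
  rw [convexHull_insert (hne.image _), hconv.convexHull_eq, mem_convexJoin] at hy
  obtain ⟨v', rfl, _, ⟨p, hp, rfl⟩, α, β, hα, hβ, hsum, rfl⟩ := hy
  simp only [Pi.add_apply, Pi.smul_apply, hv, snocZero_last, smul_eq_mul, mul_one, mul_zero,
    add_zero]
  refine ⟨hα, ?_⟩
  rintro rfl
  obtain rfl : β = 1 := by linarith
  exact ⟨p, hp, by simp⟩

theorem isExtreme_pyramid_base {d : ℕ} {P : Set (Euc d)} {v : Euc (d + 1)}
    (hP : Convex ℝ P) (hv : v (Fin.last d) = 1) :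
    IsExtreme ℝ (Pyramid d P v) (snocZero d '' P) := by
  refine ⟨fun y hy => subset_convexHull ℝ _ (Or.inl hy), ?_⟩
  rintro a ha b hb _ ⟨p, hp, rfl⟩ ⟨α, β, hα, hβ, hsum, hab⟩
  obtain ⟨ha0, ha1⟩ := last_nonneg_of_mem_pyramid hP hv ha
  obtain ⟨hb0, -⟩ := last_nonneg_of_mem_pyramid hP hv hb
  refine ha1 ?_
  have h0 := congrFun hab (Fin.last d)
  simp only [Pi.add_apply, Pi.smul_apply, snocZero_last, smul_eq_mul] at h0
  have h1 : 0 ≤ β * b (Fin.last d) := by positivity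
  have h2 : 0 ≤ α * a (Fin.last d) := by positivity
  have h3 : α * a (Fin.last d) = 0 := by linarith
  exact (mul_eq_zero.1 h3).resolve_left hα.ne'

theorem snocZero_mem_vtx_pyramid {d : ℕ} {P : Set (Euc d)} {v : Euc (d + 1)}
    (hP : Convex ℝ P) (hv : v (Fin.last d) = 1) {p : Euc d} :
    snocZero d p ∈ Vtx (Pyramid d P v) ↔ p ∈ Vtx P := by
  have hbase := isExtreme_pyramid_base hP hv
  have himg : IsExtreme ℝ (snocZero d '' P) {snocZero d p} ↔ IsExtreme ℝ P {p} := by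
    rw [← image_singleton, IsExtreme.image_iff (snocZero_injective d)]
  unfold Vtx
  rw [← isExtreme_singleton, ← isExtreme_singleton, ← himg]
  refine ⟨fun h => h.mono hbase.subset ?_, hbase.trans⟩
  have hp : snocZero d p ∈ Pyramid d P v := h.subset rfl
  exact singleton_subset_iff.2
    ((last_nonneg_of_mem_pyramid hP hv hp).2 (snocZero_last p))

theorem vtx_pyramid_subset {d : ℕ} {P : Set (Euc d)} {v : Euc (d + 1)}
    (hP : Convex ℝ P) (hv : v (Fin.last d) = 1) {y : Euc (d + 1)}
    (hy : y ∈ Vtx (Pyramid d P v)) : y = v ∨ ∃ p ∈ Vtx P, snocZero d p = y := by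
  rcases extremePoints_convexHull_subset hy with ⟨p, -, rfl⟩ | rfl
  · exact Or.inr ⟨p, (snocZero_mem_vtx_pyramid hP hv).1 hy, rfl⟩
  · exact Or.inl rfl

theorem polyAdj_pyramid_iff {d : ℕ} {P : Set (Euc d)} {v : Euc (d + 1)}
    (hP : Convex ℝ P) (hv : v (Fin.last d) = 1) {p q : Euc d} :
    PolyAdj (Pyramid d P v) (snocZero d p) (snocZero d q) ↔ PolyAdj P p q := by
  have hbase := isExtreme_pyramid_base hP hv
  have hseg : segment ℝ (snocZero d p) (snocZero d q) = snocZero d '' segment ℝ p q :=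
    (image_segment ℝ (snocZero d).toAffineMap p q).symm
  unfold PolyAdj
  rw [snocZero_mem_vtx_pyramid hP hv, snocZero_mem_vtx_pyramid hP hv, hseg,
    (snocZero_injective d).ne_iff]
  refine and_congr_right fun _ => and_congr_right fun hp => and_congr_right fun hq => ?_
  rw [← IsExtreme.image_iff (snocZero_injective d)]
  exact ⟨fun h => h.mono hbase.subset (image_mono (hP.segment_subset hp.1 hq.1)), hbase.trans⟩

theorem IsPolytope.convex {d : ℕ} {P : Set (Euc d)} (hP : IsPolytope d P) : Convex ℝ P := by
  obtain ⟨S, rfl, -⟩ := hP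
  exact convex_convexHull ℝ _

theorem IsPolytope.finite_vtx {d : ℕ} {P : Set (Euc d)} (hP : IsPolytope d P) :
    (Vtx P).Finite := by
  obtain ⟨S, rfl, -⟩ := hP
  exact S.finite_toSet.subset extremePoints_convexHull_subset

theorem PolyAdj.symm {d : ℕ} {P : Set (Euc d)} {u v : Euc d} (h : PolyAdj P u v) :
    PolyAdj P v u :=
  ⟨h.1.symm, h.2.2.1, h.2.1, segment_symm ℝ u v ▸ h.2.2.2⟩

theorem IsSecondMinVtx.eq_of_lt {d : ℕ} {P : Set (Euc d)} {f : Euc d →ₗ[ℝ] ℝ} {s w x : Euc d}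
    (hw : IsSecondMinVtx P f s w) (hx : x ∈ Vtx P) (h : f x < f w) : x = s := by
  by_contra hxs
  by_cases hxw : x = w
  · exact h.ne (hxw ▸ rfl)
  · exact (hw.2.2 x hx hxs hxw).asymm h

/-- After reversing the edge from the lowest to the second lowest vertex, the second lowest vertex
is a source. -/
theorem isSource_reverseEdge {d : ℕ} {P : Set (Euc d)} {f : Euc d →ₗ[ℝ] ℝ} {s w : Euc d}
    (hw : IsSecondMinVtx P f s w) : IsSource (Vtx P) (ReverseEdge (LPDigraph P f) s w) w := by
  refine ⟨hw.1, ?_⟩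
  rintro x hx (⟨⟨-, hlt⟩, hne⟩ | ⟨-, h⟩)
  · exact hne ⟨hw.eq_of_lt hx hlt, rfl⟩
  · exact hw.2.1 h

theorem isSink_reverseEdge {d : ℕ} {P : Set (Euc d)} {f : Euc d →ₗ[ℝ] ℝ} {s w t : Euc d}
    (ht : IsMaxVtx P f t) (htw : t ≠ w) :
    IsSink (Vtx P) (ReverseEdge (LPDigraph P f) s w) t := by
  refine ⟨ht.1, ?_⟩
  rintro x hx (⟨⟨⟨hne, -⟩, hlt⟩, -⟩ | ⟨h, -⟩)
  · exact (ht.2 x hx hne.symm).asymm hlt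
  · exact htw h

theorem uniqueSource_reverseEdge {d : ℕ} {P : Set (Euc d)} {f : Euc d →ₗ[ℝ] ℝ} {s w : Euc d}
    (hP : IsPolytope d P) (hs : IsMinVtx P f s) (hw : IsSecondMinVtx P f s w) :
    UniqueSource (Vtx P) (ReverseEdge (LPDigraph P f) s w) w := by
  refine ⟨isSource_reverseEdge hw, fun x ⟨hx, hsrc⟩ => ?_⟩
  by_contra hxw
  by_cases hxs : x = s
  · exact hsrc w hw.1 (Or.inr ⟨rfl, hxs⟩)
  obtain ⟨y, hadj, hlt⟩ := exists_polyAdj_lt hP hx hs.1.1 (-f) (neg_lt_neg (hs.2 x hx hxs))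
  exact hsrc y hadj.2.2.1 (Or.inl ⟨⟨hadj.symm, neg_lt_neg_iff.1 hlt⟩, fun h => hxw h.2⟩)

/-- Three distinct extreme points are not collinear. -/
theorem sub_notMem_span_of_mem_vtx {d : ℕ} {P : Set (Euc d)} {a b c : Euc d} (ha : a ∈ Vtx P)
    (hb : b ∈ Vtx P) (hc : c ∈ Vtx P) (hab : b ≠ a) (hac : c ≠ a) (hbc : c ≠ b) :
    c - a ∉ Submodule.span ℝ {b - a} := by
  rw [Submodule.mem_span_singleton]
  rintro ⟨r, hr⟩
  obtain rfl : c = a + r • (b - a) := by rw [hr, add_sub_cancel]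
  rcases lt_trichotomy r 0 with h0 | rfl | h0
  · refine hab (ha.2 hb.1 hc.1 ⟨-r / (1 - r), 1 / (1 - r), ?_, ?_, ?_, ?_⟩)
    · exact div_pos (by linarith) (by linarith)
    · exact div_pos one_pos (by linarith)
    · have : 1 - r ≠ 0 := by linarith
      field_simp
      ring
    · have : 1 - r ≠ 0 := by linarith
      ext i
      simp only [Pi.add_apply, Pi.smul_apply, Pi.sub_apply, smul_eq_mul]
      field_simp
      ring
  · simp at hac
  rcases lt_trichotomy r 1 with h1 | rfl | h1
  · refine hac (hc.2 ha.1 hb.1 ⟨1 - r, r, by linarith, h0, by ring, ?_⟩).symm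
    ext i
    simp only [Pi.add_apply, Pi.smul_apply, Pi.sub_apply, smul_eq_mul]
    ring
  · simp at hbc
  · refine hab (hb.2 ha.1 hc.1 ⟨1 - 1 / r, 1 / r, ?_, by positivity, by ring, ?_⟩).symm
    · rw [sub_pos, div_lt_one h0]
      exact h1
    · ext i
      simp only [Pi.add_apply, Pi.smul_apply, Pi.sub_apply, smul_eq_mul]
      field_simp
      ring

/-- A vertex of a polytope with at least three vertices has a second neighbour. -/
theorem exists_polyAdj_ne {d : ℕ} {P : Set (Euc d)} (hP : IsPolytope d P) {s w t : Euc d}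
    (hs : s ∈ Vtx P) (hw : w ∈ Vtx P) (ht : t ∈ Vtx P) (hws : w ≠ s) (hts : t ≠ s)
    (htw : t ≠ w) : ∃ y, PolyAdj P s y ∧ y ≠ w := by
  obtain ⟨g, hgt, hg⟩ :=
    Submodule.exists_le_ker_of_notMem (sub_notMem_span_of_mem_vtx hs hw ht hws hts htw)
  have hgw : g w = g s := by
    have := hg (Submodule.mem_span_singleton_self (w - s))
    rwa [LinearMap.mem_ker, map_sub, sub_eq_zero] at this
  rw [map_sub, sub_ne_zero] at hgt
  obtain hlt | hlt := lt_or_gt_of_ne hgt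
  · obtain ⟨y, hy, hgy⟩ := exists_polyAdj_lt hP hs ht.1 (-g) (neg_lt_neg hlt)
    exact ⟨y, hy, by rintro rfl; exact (neg_lt_neg_iff.1 hgy).ne hgw⟩
  · obtain ⟨y, hy, hgy⟩ := exists_polyAdj_lt hP hs ht.1 g hlt
    exact ⟨y, hy, by rintro rfl; exact hgy.ne' hgw⟩

theorem uniqueSink_reverseEdge {d : ℕ} {P : Set (Euc d)} {f : Euc d →ₗ[ℝ] ℝ} {s w t : Euc d}
    (hP : IsPolytope d P) (hs : IsMinVtx P f s) (hw : IsSecondMinVtx P f s w)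
    (ht : IsMaxVtx P f t) (htw : t ≠ w) :
    UniqueSink (Vtx P) (ReverseEdge (LPDigraph P f) s w) t := by
  refine ⟨isSink_reverseEdge ht htw, fun x ⟨hx, hsink⟩ => ?_⟩
  by_contra hxt
  by_cases hxs : x = s
  · subst hxs
    obtain ⟨y, hadj, hyw⟩ :=
      exists_polyAdj_ne hP hs.1 hw.1 ht.1 hw.2.1 (Ne.symm hxt) htw
    exact hsink y hadj.2.2.1
      (Or.inl ⟨⟨hadj, hs.2 y hadj.2.2.1 hadj.1.symm⟩, fun h => hyw h.2⟩)
  obtain ⟨y, hadj, hlt⟩ := exists_polyAdj_lt hP hx ht.1.1 f (ht.2 x hx hxt)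
  exact hsink y hadj.2.2.1 (Or.inl ⟨⟨hadj, hlt⟩, fun h => hxs h.1⟩)

/-- If there are only two vertices, reversing the edge between them preserves the Holt-Klee
condition. -/
theorem satisfiesHK_reverseEdge_of_isMaxVtx {d : ℕ} {P : Set (Euc d)} {f : Euc d →ₗ[ℝ] ℝ}
    {s w : Euc d} (hs : IsMinVtx P f s) (hw : IsSecondMinVtx P f s w) (hmax : IsMaxVtx P f w)
    (k : ℕ) : SatisfiesHK k (Vtx P) (ReverseEdge (LPDigraph P f) s w) := by
  have htwo : ∀ x ∈ Vtx P, x = s ∨ x = w := fun x hx => by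
    by_contra! h
    exact (hw.2.2 x hx h.1 h.2).asymm (hmax.2 x hx h.2)
  have hws : ReverseEdge (LPDigraph P f) s w w s := Or.inr ⟨rfl, rfl⟩
  refine ⟨w, s, ⟨isSource_reverseEdge hw, ?_⟩, ⟨⟨hs.1, ?_⟩, ?_⟩, fun _ => [w, s],
    fun _ => ⟨?_, rfl, rfl, ?_⟩, fun _ _ _ x hx _ => by simpa using hx⟩
  · rintro x ⟨hx, hsrc⟩
    exact (htwo x hx).resolve_left fun h => hsrc w hw.1 (h ▸ hws)
  · rintro x hx (⟨⟨⟨hne, -⟩, -⟩, hsw⟩ | ⟨h, -⟩)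
    · exact hsw ⟨rfl, (htwo x hx).resolve_left hne.symm⟩
    · exact hw.2.1 h.symm
  · rintro x ⟨hx, hsink⟩
    exact (htwo x hx).resolve_right fun h => hsink s hs.1 (h ▸ hws)
  · exact List.isChain_pair.2 hws
  · simpa using hw.2.1

theorem IsDipath.forall_mem {α : Type*} {D : α → α → Prop} {Q : α → Prop} {s t : α} {p : List α}
    (hp : IsDipath D s t p) (hs : Q s) (hD : ∀ x y, D x y → Q y) : ∀ x ∈ p, Q x := by
  refine List.IsChain.induction Q p hp.1 (fun x y hxy _ => hD x y hxy) fun hne => ?_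
  have := hp.2.1
  rw [List.head?_eq_some_head hne, Option.some.injEq] at this
  exact this ▸ hs

theorem IsDipath.map {α β : Type*} {D : α → α → Prop} {E : β → β → Prop} {s t : α} {p : List α}
    (hp : IsDipath D s t p) (φ : α → β) (hinj : Set.InjOn φ {x | x ∈ p})
    (hE : ∀ x ∈ p, ∀ y ∈ p, D x y → E (φ x) (φ y)) : IsDipath E (φ s) (φ t) (p.map φ) := by
  obtain ⟨hc, hh, hl, hn⟩ := hp
  refine ⟨?_, by simp [hh], by simp [hl], hn.map_on fun x hx y hy h => hinj hx hy h⟩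
  refine (List.isChain_map φ).2 (List.IsChain.imp_of_mem_imp (fun x y hx hy h => ?_) hc)
  exact hE x hx y hy h

/-- Among `k + 1` internally disjoint paths, `k` avoid a given internal point. -/
theorem HKPaths.avoid {α : Type*} {D : α → α → Prop} {s t : α} {k : ℕ}
    (h : HKPaths D s t (k + 1)) {v : α} (hvs : v ≠ s) (hvt : v ≠ t) :
    ∃ paths : Fin k → List α, (∀ i, IsDipath D s t (paths i) ∧ v ∉ paths i) ∧
      ∀ i j, i ≠ j → InternallyDisjoint s t (paths i) (paths j) := by
  obtain ⟨paths, hpaths, hdisj⟩ := h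
  obtain ⟨i₀, hi₀⟩ : ∃ i₀, ∀ i, i ≠ i₀ → v ∉ paths i := by
    by_cases hv : ∃ i₀, v ∈ paths i₀
    · obtain ⟨i₀, hi₀⟩ := hv
      refine ⟨i₀, fun i hi hmem => ?_⟩
      exact (hdisj i i₀ hi v hmem hi₀).elim hvs hvt
    · exact ⟨0, fun i _ hmem => hv ⟨i, hmem⟩⟩
  exact ⟨fun i => paths (i₀.succAbove i),
    fun i => ⟨hpaths _, hi₀ _ (Fin.succAbove_ne i₀ i)⟩,
    fun i j hij => hdisj _ _ (Fin.succAbove_right_injective.ne hij)⟩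

/-- The functional on `ℝ^{d+1}` extending `f` and taking the value `m` at `v`, where `v` has last
coordinate `1`. -/
theorem exists_extension {d : ℕ} (f : Euc d →ₗ[ℝ] ℝ) {v : Euc (d + 1)}
    (hv : v (Fin.last d) = 1) (m : ℝ) :
    ∃ F : Euc (d + 1) →ₗ[ℝ] ℝ, (∀ p, F (snocZero d p) = f p) ∧ F v = m := by
  let π : Euc (d + 1) →ₗ[ℝ] Euc d := LinearMap.funLeft ℝ ℝ Fin.castSucc
  refine ⟨f ∘ₗ π + (m - f (π v)) • LinearMap.proj (Fin.last d), fun p => ?_, ?_⟩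
  · have : π (snocZero d p) = p := init_snocZero p
    simp [this]
  · simp [hv]

theorem HKPaths.of_pyramid {d : ℕ} {P : Set (Euc d)} {v : Euc (d + 1)} {f : Euc d →ₗ[ℝ] ℝ}
    {F : Euc (d + 1) →ₗ[ℝ] ℝ} {s w t : Euc d} {k : ℕ} (hP : Convex ℝ P)
    (hv : v (Fin.last d) = 1) (hF : ∀ p, F (snocZero d p) = f p) (hs : s ∈ Vtx P)
    (hw : w ∈ Vtx P)
    (h : HKPaths (ReverseEdge (LPDigraph (Pyramid d P v) F) (snocZero d s) (snocZero d w))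
      (snocZero d w) (snocZero d t) (k + 1)) :
    HKPaths (ReverseEdge (LPDigraph P f) s w) w t k := by
  have hne : ∀ p, v ≠ snocZero d p := by
    rintro p rfl
    simp at hv
  obtain ⟨paths, hpaths, hdisj⟩ := h.avoid (hne w) (hne t)
  have hmem : ∀ i, ∀ x ∈ paths i, ∃ p ∈ Vtx P, snocZero d p = x := fun i x hx => by
    have hxv : x ∈ Vtx (Pyramid d P v) := by
      refine (hpaths i).1.forall_mem (Q := (· ∈ Vtx (Pyramid d P v))) ?_ ?_ x hx
      · exact (snocZero_mem_vtx_pyramid hP hv).2 hw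
      · rintro x y (⟨⟨hadj, -⟩, -⟩ | ⟨-, rfl⟩)
        · exact hadj.2.2.1
        · exact (snocZero_mem_vtx_pyramid hP hv).2 hs
    refine (vtx_pyramid_subset hP hv hxv).resolve_left ?_
    rintro rfl
    exact (hpaths i).2 hx
  refine ⟨fun i => (paths i).map fun y => (Fin.init y : Euc d), fun i => ?_, fun i j hij => ?_⟩
  · have := (hpaths i).1.map (E := ReverseEdge (LPDigraph P f) s w)
      (fun y => (Fin.init y : Euc d)) ?_ ?_
    · simpa using this
    · intro x hx y hy hxy
      obtain ⟨p, -, rfl⟩ := hmem i x hx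
      obtain ⟨q, -, rfl⟩ := hmem i y hy
      simp only [init_snocZero] at hxy
      rw [hxy]
    · intro x hx y hy hxy
      obtain ⟨p, -, rfl⟩ := hmem i x hx
      obtain ⟨q, -, rfl⟩ := hmem i y hy
      simpa only [ReverseEdge, LPDigraph, polyAdj_pyramid_iff hP hv, hF, init_snocZero,
        (snocZero_injective d).eq_iff] using hxy
  · intro x hxi hxj
    obtain ⟨y, hy, rfl⟩ := List.mem_map.1 hxi
    obtain ⟨z, hz, hzy⟩ := List.mem_map.1 hxj
    obtain ⟨p, -, rfl⟩ := hmem i y hy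
    obtain ⟨q, -, rfl⟩ := hmem j z hz
    simp only [init_snocZero] at hzy ⊢
    subst hzy
    simpa only [(snocZero_injective d).eq_iff] using hdisj i j hij _ hy hz

theorem AdmitsSensitiveLP.pyramid {d : ℕ} {P : Set (Euc d)} {v : Euc (d + 1)}
    (hP : IsPolytope d P) (hv : v (Fin.last d) = 1) (hadm : AdmitsSensitiveLP d P) :
    AdmitsSensitiveLP (d + 1) (Pyramid d P v) := by
  obtain ⟨f, s, w, hgen, hs, hw, hadj, hHK⟩ := hadm
  obtain ⟨t, ht, hmax⟩ := hP.finite_vtx.exists_maximalFor f _ ⟨s, hs.1⟩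
  have ht' : IsMaxVtx P f t := ⟨ht, fun x hx hxt => (not_le.1 fun hle =>
    hxt (hgen hx ht (le_antisymm (hmax hx hle) hle)))⟩
  have htw : t ≠ w := by
    rintro rfl
    exact hHK (satisfiesHK_reverseEdge_of_isMaxVtx hs hw ht' d)
  obtain ⟨m, ⟨hwm, hmt⟩, hm⟩ :=
    (Ioo_infinite (ht'.2 w hw.1 htw.symm)).exists_notMem_finite (hP.finite_vtx.image f)
  obtain ⟨F, hF, hFv⟩ := exists_extension f hv m
  have hPc := hP.convex
  have hmv : ∀ {p}, snocZero d p ∈ Vtx (Pyramid d P v) ↔ p ∈ Vtx P :=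
    snocZero_mem_vtx_pyramid hPc hv
  have hinj := snocZero_injective d
  have hsw : f s < f w := hs.2 w hw.1 hw.2.1
  have hw' : IsSecondMinVtx (Pyramid d P v) F (snocZero d s) (snocZero d w) := by
    refine ⟨hmv.2 hw.1, hinj.ne hw.2.1, fun x hx hxs hxw => ?_⟩
    rcases vtx_pyramid_subset hPc hv hx with rfl | ⟨p, hp, rfl⟩
    · rwa [hF, hFv]
    · rw [hF, hF]
      exact hw.2.2 p hp (ne_of_apply_ne _ hxs) (ne_of_apply_ne _ hxw)
  have htP : IsMaxVtx (Pyramid d P v) F (snocZero d t) := by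
    refine ⟨hmv.2 ht, fun x hx hxt => ?_⟩
    rcases vtx_pyramid_subset hPc hv hx with rfl | ⟨p, hp, rfl⟩
    · rwa [hF, hFv]
    · rw [hF, hF]
      exact ht'.2 p hp (ne_of_apply_ne _ hxt)
  refine ⟨F, snocZero d s, snocZero d w, ?_, ⟨hmv.2 hs.1, fun x hx hxs => ?_⟩, hw',
    (polyAdj_pyramid_iff hPc hv).2 hadj, ?_⟩
  · intro x hx y hy hxy
    rcases vtx_pyramid_subset hPc hv hx with rfl | ⟨p, hp, rfl⟩ <;>
      rcases vtx_pyramid_subset hPc hv hy with rfl | ⟨q, hq, rfl⟩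
    · rfl
    · exact absurd ⟨q, hq, by rw [← hF, ← hxy, hFv]⟩ hm
    · exact absurd ⟨p, hp, by rw [← hF, hxy, hFv]⟩ hm
    · rw [hgen hp hq (by rwa [hF, hF] at hxy)]
  · rcases vtx_pyramid_subset hPc hv hx with rfl | ⟨p, hp, rfl⟩
    · rw [hF, hFv]
      exact hsw.trans hwm
    · rw [hF, hF]
      exact hs.2 p hp (ne_of_apply_ne _ hxs)
  · rintro ⟨s', t', hs', ht'', hpaths⟩
    obtain rfl := hs'.2 _ (isSource_reverseEdge hw')
    obtain rfl := ht''.2 _ (isSink_reverseEdge htP (hinj.ne htw))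
    exact hHK ⟨w, t, uniqueSource_reverseEdge hP hs hw, uniqueSink_reverseEdge hP hs hw ht' htw,
      hpaths.of_pyramid hPc hv hF hs.1 hw.1⟩

/-- Let `P` be a `d`-polytope in `ℝ^d` and `v ∈ ℝ^{d+1}` a
point whose last coordinate is `1`. If `P` admits a sensitive LP digraph, then
the pyramid polytope `py(P, v)`, which is a `(d+1)`-polytope in `ℝ^{d+1}`,
also admits a sensitive LP digraph. -/
theorem pyramid_sensitiveLP (d : ℕ) (P : Set (Euc d)) (v : Euc (d + 1))
    (hP : IsPolytope d P) (hv : v (Fin.last d) = 1)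
    (hadm : AdmitsSensitiveLP d P) :
    IsPolytope (d + 1) (Pyramid d P v) ∧
    AdmitsSensitiveLP (d + 1) (Pyramid d P v) := by
  exact ⟨hP.pyramid hv, hadm.pyramid hP hv⟩
end

section
/- For each d ≥ 3 and each n ≥ d+3, there exists a d-polytope in ℝ^d with exactly n vertices whose graph admits a sensitive LP digraph. -/
open Set

section Faces

variable {E : Type*} [AddCommGroup E] [Module ℝ E]

/-- If every point of `S` either lies in the convex set `F` on the hyperplane `g = M` or strictly
below that hyperplane, then the same holds for the convex hull of `S`. -/
theorem convexHull_subset_union_lt {S F : Set E} {g : E →ₗ[ℝ] ℝ} {M : ℝ} (hF : Convex ℝ F)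
    (hgF : ∀ x ∈ F, g x = M) (hS : ∀ x ∈ S, x ∈ F ∨ g x < M) {x : E}
    (hx : x ∈ convexHull ℝ S) : x ∈ F ∨ g x < M := by
  have hconv : Convex ℝ {x | x ∈ F ∨ g x < M} := by
    refine convex_iff_forall_pos.2 fun u hu v hv a b ha hb hab => ?_
    by_cases h : u ∈ F ∧ v ∈ F
    · exact Or.inl (hF h.1 h.2 ha.le hb.le hab)
    · right
      have hM : M = a * M + b * M := by rw [← add_mul, hab, one_mul]
      have hu' : g u ≤ M := hu.elim (fun h => (hgF u h).le) le_of_lt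
      have hv' : g v ≤ M := hv.elim (fun h => (hgF v h).le) le_of_lt
      have hau := mul_le_mul_of_nonneg_left hu' ha.le
      have hbv := mul_le_mul_of_nonneg_left hv' hb.le
      simp only [map_add, map_smul, smul_eq_mul]
      rw [not_and_or] at h
      rcases h with h | h
      · have := mul_lt_mul_of_pos_left (hu.resolve_left h) ha
        linarith
      · have := mul_lt_mul_of_pos_left (hv.resolve_left h) hb
        linarith
  exact convexHull_min (t := {x | x ∈ F ∨ g x < M}) hS hconv hx

/-- A convex subset of `convexHull ℝ S` cut out by a supporting hyperplane is a face. -/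
theorem isExtreme_convexHull_of_supporting {S F : Set E} (g : E →ₗ[ℝ] ℝ) (M : ℝ)
    (hF : Convex ℝ F) (hFS : F ⊆ convexHull ℝ S) (hgF : ∀ x ∈ F, g x = M)
    (hS : ∀ x ∈ S, x ∈ F ∨ g x < M) : IsExtreme ℝ (convexHull ℝ S) F := by
  refine ⟨hFS, ?_⟩
  rintro u hu v hv x hx ⟨a, b, ha, hb, hab, rfl⟩
  have hu' := convexHull_subset_union_lt hF hgF hS hu
  have hv' := convexHull_subset_union_lt hF hgF hS hv
  refine hu'.resolve_right fun hlt => ?_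
  have hvM : g v ≤ M := hv'.elim (fun h => (hgF v h).le) le_of_lt
  have hM : M = a * M + b * M := by rw [← add_mul, hab, one_mul]
  have hx' := hgF _ hx
  simp only [map_add, map_smul, smul_eq_mul] at hx'
  have h1 := mul_lt_mul_of_pos_left hlt ha
  have h2 := mul_le_mul_of_nonneg_left hvM hb.le
  linarith

/-- A point of `S` at which a linear functional has its strict maximum over `S` is an extreme
point of the convex hull. -/
theorem mem_extremePoints_convexHull_of_lt {S : Set E} {x : E} (g : E →ₗ[ℝ] ℝ) (hx : x ∈ S)
    (hS : ∀ y ∈ S, y ≠ x → g y < g x) : x ∈ (convexHull ℝ S).extremePoints ℝ := by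
  rw [← isExtreme_singleton]
  refine isExtreme_convexHull_of_supporting g (g x) (convex_singleton x)
    (singleton_subset_iff.2 (subset_convexHull ℝ S hx)) (by simp) fun y hy => ?_
  by_cases h : y = x
  · exact Or.inl h
  · exact Or.inr (hS y hy h)

/-- If `a u + b v = a' q + b' r` is a relation between points of `P`, with positive coefficients
of equal sums, and `q` is a vertex different from `u` and `v`, then `[u, v]` is not a face. -/
theorem not_isExtreme_segment_of_relation {P : Set E} {u v q r : E}
    (hq : q ∈ P.extremePoints ℝ) (hr : r ∈ P) (hu : u ∈ P) (hv : v ∈ P) (hqu : u ≠ q)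
    (hqv : v ≠ q) {a b a' b' : ℝ} (ha : 0 < a) (hb : 0 < b) (ha' : 0 < a') (hb' : 0 < b')
    (hsum : a + b = a' + b') (h : a • u + b • v = a' • q + b' • r) :
    ¬ IsExtreme ℝ P (segment ℝ u v) := by
  intro hext
  have hpos : 0 < a + b := by positivity
  have hmem : (a + b)⁻¹ • (a • u + b • v) ∈ segment ℝ u v := by
    refine ⟨(a + b)⁻¹ * a, (a + b)⁻¹ * b, by positivity, by positivity, ?_, ?_⟩
    · field_simp
    · simp only [smul_add, smul_smul]
  have hopen : (a + b)⁻¹ • (a • u + b • v) ∈ openSegment ℝ q r := by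
    refine ⟨(a + b)⁻¹ * a', (a + b)⁻¹ * b', by positivity, by positivity, ?_, ?_⟩
    · rw [← mul_add, ← hsum, inv_mul_cancel₀ hpos.ne']
    · rw [h]; simp only [smul_add, smul_smul]
  have hqseg := hext.2 hq.1 hr hmem hopen
  rcases (mem_extremePoints_iff_forall_segment.1 hq).2 u hu v hv hqseg with h | h
  · exact hqu h
  · exact hqv h

end Faces

section Paths

variable {α : Type*}

/-- A directed walk that starts in `A` and ends outside `A` meets every set `C` through which all
arcs leaving `A` pass. -/
theorem exists_mem_cut_of_isChain {D : α → α → Prop} {A C : Set α}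
    (hD : ∀ u v, u ∈ A → D u v → v ∈ A ∨ v ∈ C) {t : α} (ht : t ∉ A) (p : List α) :
    ∀ s, s ∈ A → p.IsChain D → p.head? = some s → p.getLast? = some t → ∃ x ∈ p, x ∈ C := by
  induction p with
  | nil => intro s _ _ h; simp at h
  | cons x p ih =>
    intro s hs hp hhead hlast
    obtain rfl : x = s := by simpa using hhead
    cases p with
    | nil =>
      obtain rfl : x = t := by simpa using hlast
      exact absurd hs ht
    | cons y p =>
      rw [List.isChain_cons_cons] at hp
      rcases hD x y hs hp.1 with hy | hy
      · obtain ⟨z, hz, hzC⟩ := ih y hy hp.2 rfl (by simpa using hlast)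
        exact ⟨z, List.mem_cons_of_mem _ hz, hzC⟩
      · exact ⟨y, by simp, hy⟩

/-- A cut of `k` vertices between `s` and `t` precludes `k + 1` internally disjoint paths. -/
theorem not_hkPaths_of_cut {D : α → α → Prop} {s t : α} {A : Set α} {k : ℕ} (κ : Fin k → α)
    (hs : s ∈ A) (ht : t ∉ A) (hκs : ∀ i, κ i ≠ s) (hκt : ∀ i, κ i ≠ t)
    (hD : ∀ u v, u ∈ A → D u v → v ∈ A ∨ v ∈ range κ) : ¬ HKPaths D s t (k + 1) := by
  rintro ⟨p, hp, hdisj⟩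
  have hmeet : ∀ i, ∃ j, κ j ∈ p i := fun i => by
    obtain ⟨x, hx, j, rfl⟩ :=
      exists_mem_cut_of_isChain hD ht (p i) s hs (hp i).1 (hp i).2.1 (hp i).2.2.1
    exact ⟨j, hx⟩
  choose j hj using hmeet
  obtain ⟨i₁, i₂, hne, heq⟩ := Fintype.exists_ne_map_eq_of_card_lt j (by simp)
  rcases hdisj i₁ i₂ hne _ (hj i₁) (heq ▸ hj i₂) with h | h
  · exact hκs _ h
  · exact hκt _ h

end Paths

/-- After reversing the edge between the two lowest vertices `s, w`, the vertex `w` is a source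
and the top vertex `t` is a sink; so a failure of the path condition between `w` and `t` makes
the marked LP digraph sensitive. -/
theorem not_satisfiesHK_reverseEdge {d : ℕ} {P : Set (Euc d)} {f : Euc d →ₗ[ℝ] ℝ}
    {s w t : Euc d} (hw : IsSecondMinVtx P f s w) (ht : IsMaxVtx P f t)
    (hwt : w ≠ t)
    (hpaths : ¬ HKPaths (ReverseEdge (LPDigraph P f) s w) w t d) :
    ¬ SatisfiesHK d (Vtx P) (ReverseEdge (LPDigraph P f) s w) := by
  rintro ⟨s', t', hs', ht', hp⟩
  have hsource : IsSource (Vtx P) (ReverseEdge (LPDigraph P f) s w) w := by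
    refine ⟨hw.1, fun x hx h => ?_⟩
    rcases h with ⟨⟨_, hlt⟩, hn⟩ | ⟨_, h⟩
    · have hxs : x ≠ s := fun h => hn ⟨h, rfl⟩
      by_cases hxw : x = w
      · exact (hxw ▸ hlt).false
      · exact (hw.2.2 x hx hxs hxw).asymm hlt
    · exact hw.2.1 h
  have hsink : IsSink (Vtx P) (ReverseEdge (LPDigraph P f) s w) t := by
    refine ⟨ht.1, fun x hx h => ?_⟩
    rcases h with ⟨⟨_, hlt⟩, _⟩ | ⟨h, _⟩
    · by_cases hxt : x = t
      · exact (hxt ▸ hlt).false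
      · exact (ht.2 x hx hxt).asymm hlt
    · exact hwt h.symm
  rw [← hs'.2 w hsource, ← ht'.2 t hsink] at hp
  exact hpaths hp

section Construction

variable {m : ℕ}

/-- The point of `ℝ^(m+3)` with given first three coordinates and given remaining ones. -/
def mkPoint (x y z : ℝ) (τ : Fin m → ℝ) : Euc (m + 3) :=
  Fin.cons x (Fin.cons y (Fin.cons z τ))

@[simp]
theorem mkPoint_zero (x y z : ℝ) (τ : Fin m → ℝ) : mkPoint x y z τ 0 = x := rfl

@[simp]
theorem mkPoint_one (x y z : ℝ) (τ : Fin m → ℝ) : mkPoint x y z τ 1 = y := rfl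

@[simp]
theorem mkPoint_two (x y z : ℝ) (τ : Fin m → ℝ) : mkPoint x y z τ 2 = z := rfl

@[simp]
theorem mkPoint_succ (x y z : ℝ) (τ : Fin m → ℝ) (j : Fin m) :
    mkPoint x y z τ j.succ.succ.succ = τ j := rfl

/-- The linear functional on `ℝ^(m+3)` with given coefficients. -/
def mkFunctional (α β γ : ℝ) (δ : Fin m → ℝ) : Euc (m + 3) →ₗ[ℝ] ℝ where
  toFun v := mkPoint α β γ δ ⬝ᵥ v
  map_add' := dotProduct_add _
  map_smul' c v := dotProduct_smul c _ v

theorem mkFunctional_mkPoint (α β γ x y z : ℝ) (δ τ : Fin m → ℝ) :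
    mkFunctional α β γ δ (mkPoint x y z τ) = α * x + β * y + γ * z + δ ⬝ᵥ τ := by
  simp [mkFunctional, dotProduct, Fin.sum_univ_succ, add_assoc]

theorem smul_mkPoint_add_smul_mkPoint (a b x y z x' y' z' : ℝ) :
    a • mkPoint x y z (0 : Fin m → ℝ) + b • mkPoint x' y' z' 0 =
      mkPoint (a * x + b * x') (a * y + b * y') (a * z + b * z') 0 := by
  funext i
  refine Fin.cases ?_ (fun i => Fin.cases ?_ (fun i => Fin.cases ?_ (fun i => ?_) i) i) i <;>
    simp

/-- A sequence of distinct parameters in `(5/6, 1]` starting at `1`. -/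
noncomputable def arcParam (i : ℕ) : ℝ := 5 / 6 + 1 / (6 * (i + 1))

theorem arcParam_zero : arcParam 0 = 1 := by norm_num [arcParam]

theorem arcParam_gt (i : ℕ) : 5 / 6 < arcParam i := by
  have : (0 : ℝ) < 1 / (6 * (i + 1)) := by positivity
  unfold arcParam; linarith

theorem arcParam_le_one (i : ℕ) : arcParam i ≤ 1 := by
  have : (1 : ℝ) / (6 * (i + 1)) ≤ 1 / 6 := by
    apply one_div_le_one_div_of_le (by norm_num)
    have : (0 : ℝ) ≤ i := Nat.cast_nonneg i
    linarith
  unfold arcParam; linarith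

theorem arcParam_injective : Function.Injective arcParam := by
  intro i j h
  have hi : (i : ℝ) + 1 ≠ 0 := by positivity
  have hj : (j : ℝ) + 1 ≠ 0 := by positivity
  simp only [arcParam, add_right_inj, one_div, inv_inj] at h
  have : (i : ℝ) = j := by linarith
  exact_mod_cast this

/-- Labels for the vertices: `inl 0, …, inl 4` are the vertices `s, w, a, c, t` of a triangular
frustum, the second summand labels an arc of vertices in one side plane (the first of which is the
sixth vertex of the frustum) and the third summand labels the apexes of iterated pyramids. -/
abbrev VtxLabel (k m : ℕ) : Type := Fin 5 ⊕ Fin (k + 1) ⊕ Fin m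

/-- The vertices of the polytope. -/
noncomputable def vtxPoint (k m : ℕ) : VtxLabel k m → Euc (m + 3) :=
  Sum.elim ![mkPoint 0 0 0 0, mkPoint 0 0 1 0, mkPoint (1 / 2) 0 1 0, mkPoint 0 (1 / 2) 1 0,
      mkPoint 0 1 0 0]
    (Sum.elim (fun i => mkPoint (arcParam i) 0 (arcParam i ^ 2 - arcParam i) 0)
      (fun j => mkPoint 0 0 0 (Pi.single j 1)))

/-- The objective function. -/
noncomputable def objective (m : ℕ) : Euc (m + 3) →ₗ[ℝ] ℝ :=
  mkFunctional 3 (2 * m + 10) 2 (fun j => 4 + (j : ℝ))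

/-- A functional whose strict maximum over the vertices is attained at the given vertex. -/
noncomputable def exposing (k m : ℕ) : VtxLabel k m → (Euc (m + 3) →ₗ[ℝ] ℝ) :=
  Sum.elim ![mkFunctional (-1) (-1) (-1) (-1), mkFunctional (-1) (-1) 1 (-1),
      mkFunctional 1 (-1) 2 (-1), mkFunctional (-1) 1 2 (-1), mkFunctional 0 1 0 0]
    (Sum.elim (fun i => mkFunctional (2 * arcParam i - 1) (-1) (-1) (-1))
      (fun j => mkFunctional 0 0 0 (Pi.single j 1)))

theorem exposing_lt (k m : ℕ) (i j : VtxLabel k m) (h : j ≠ i) :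
    exposing k m i (vtxPoint k m j) < exposing k m i (vtxPoint k m i) := by
  rcases i with i | i | i <;> rcases j with j | j | j
  · fin_cases i <;> fin_cases j <;>
      first
      | exact absurd rfl h
      | (simp [exposing, vtxPoint, mkFunctional_mkPoint]; try norm_num)
  · have := arcParam_gt j
    have := arcParam_le_one j
    fin_cases i <;> simp [exposing, vtxPoint, mkFunctional_mkPoint] <;> nlinarith
  · fin_cases i <;> simp [exposing, vtxPoint, mkFunctional_mkPoint] <;> norm_num
  · have := arcParam_gt i
    have := arcParam_le_one i
    fin_cases j <;> simp [exposing, vtxPoint, mkFunctional_mkPoint] <;> nlinarith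
  · have hne : arcParam j - arcParam i ≠ 0 := by
      rw [sub_ne_zero]
      intro h'
      exact h (congrArg _ (congrArg _ (Fin.ext (arcParam_injective h'))))
    have := sq_pos_of_ne_zero hne
    simp only [exposing, vtxPoint, mkFunctional_mkPoint, Sum.elim_inr, Sum.elim_inl,
      dotProduct_zero]
    nlinarith
  · have := arcParam_gt i
    have := arcParam_le_one i
    simp [exposing, vtxPoint, mkFunctional_mkPoint]
    nlinarith
  · fin_cases j <;> simp [exposing, vtxPoint, mkFunctional_mkPoint]
  · simp [exposing, vtxPoint, mkFunctional_mkPoint]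
  · have hji : i ≠ j := fun h' => h (by rw [h'])
    simp [exposing, vtxPoint, mkFunctional_mkPoint, hji]

/-- The polytope with the prescribed vertices. -/
def sensitivePolytope (k m : ℕ) : Set (Euc (m + 3)) := convexHull ℝ (range (vtxPoint k m))

theorem vtxPoint_injective (k m : ℕ) : Function.Injective (vtxPoint k m) := by
  intro i j h
  by_contra hne
  exact (h ▸ exposing_lt k m i j (Ne.symm hne)).false

theorem vtx_sensitivePolytope (k m : ℕ) : Vtx (sensitivePolytope k m) = range (vtxPoint k m) := by
  refine extremePoints_convexHull_subset.antisymm ?_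
  rintro _ ⟨i, rfl⟩
  refine mem_extremePoints_convexHull_of_lt (exposing k m i) ⟨i, rfl⟩ ?_
  rintro _ ⟨j, rfl⟩ h
  exact exposing_lt k m i j fun hji => h (hji ▸ rfl)

theorem vtxPoint_mem_vtx (k m : ℕ) (i : VtxLabel k m) :
    vtxPoint k m i ∈ Vtx (sensitivePolytope k m) :=
  vtx_sensitivePolytope k m ▸ mem_range_self i

theorem vtxPoint_mem (k m : ℕ) (i : VtxLabel k m) : vtxPoint k m i ∈ sensitivePolytope k m :=
  (vtxPoint_mem_vtx k m i).1

theorem affineSpan_range_vtxPoint (k m : ℕ) : affineSpan ℝ (range (vtxPoint k m)) = ⊤ := by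
  have hmem : ∀ i, vtxPoint k m i ∈ affineSpan ℝ (range (vtxPoint k m)) := fun i =>
    subset_affineSpan ℝ _ (mem_range_self i)
  have hs : vtxPoint k m (Sum.inl 0) = 0 := by
    funext i
    refine Fin.cases ?_ (fun i => Fin.cases ?_ (fun i => Fin.cases ?_ (fun i => ?_) i) i) i <;>
      simp [vtxPoint]
  have hdir : ∀ i, vtxPoint k m i ∈ (affineSpan ℝ (range (vtxPoint k m))).direction := fun i => by
    have := AffineSubspace.vsub_mem_direction (hmem i) (hmem (Sum.inl 0))
    rwa [hs, vsub_eq_sub, sub_zero] at this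
  rw [← AffineSubspace.direction_eq_top_iff_of_nonempty ⟨_, hmem (Sum.inl 0)⟩, eq_top_iff]
  rintro v -
  have hv : v = v 0 • vtxPoint k m (Sum.inr (Sum.inl 0)) + v 1 • vtxPoint k m (Sum.inl 4) +
      v 2 • vtxPoint k m (Sum.inl 1) +
      ∑ j : Fin m, v j.succ.succ.succ • vtxPoint k m (Sum.inr (Sum.inr j)) := by
    funext i
    refine Fin.cases ?_ (fun i => Fin.cases ?_ (fun i => Fin.cases ?_ (fun i => ?_) i) i) i <;>
      simp [vtxPoint, arcParam_zero, Pi.single_apply]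
  rw [hv]
  exact add_mem (add_mem (add_mem (Submodule.smul_mem _ _ (hdir _))
    (Submodule.smul_mem _ _ (hdir _))) (Submodule.smul_mem _ _ (hdir _)))
    (Submodule.sum_mem _ fun j _ => Submodule.smul_mem _ _ (hdir _))

theorem objective_vtxPoint_injective (k m : ℕ) :
    Function.Injective fun i => objective m (vtxPoint k m i) := by
  have hm : (0 : ℝ) ≤ m := Nat.cast_nonneg m
  have harc : ∀ i j : Fin (k + 1), arcParam i + 2 * arcParam i ^ 2 =
      arcParam j + 2 * arcParam j ^ 2 → i = j := fun i j h => by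
    have := arcParam_gt i
    have := arcParam_gt j
    have h0 : (arcParam i - arcParam j) * (1 + 2 * (arcParam i + arcParam j)) = 0 := by
      linear_combination h
    rcases mul_eq_zero.1 h0 with h1 | h1
    · exact Fin.ext (arcParam_injective (sub_eq_zero.1 h1))
    · linarith
  have hval : ∀ j : Fin m, (0 : ℝ) ≤ (j : ℕ) ∧ ((j : ℕ) : ℝ) ≤ m := fun j =>
    ⟨Nat.cast_nonneg _, by exact_mod_cast j.2.le⟩
  rintro (i | i | i) (j | j | j) h
  · fin_cases i <;> fin_cases j <;> first
      | rfl
      | (simp [objective, vtxPoint, mkFunctional_mkPoint] at h; try linarith)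
  · have := arcParam_gt j
    have := arcParam_le_one j
    fin_cases i <;> simp [objective, vtxPoint, mkFunctional_mkPoint] at h <;> nlinarith
  · have := hval j
    fin_cases i <;> simp [objective, vtxPoint, mkFunctional_mkPoint] at h <;> linarith
  · have := arcParam_gt i
    have := arcParam_le_one i
    fin_cases j <;> simp [objective, vtxPoint, mkFunctional_mkPoint] at h <;> nlinarith
  · simp [objective, vtxPoint, mkFunctional_mkPoint] at h
    rw [harc i j (by linarith)]
  · have := arcParam_gt i
    have := arcParam_le_one i
    have := hval j
    simp [objective, vtxPoint, mkFunctional_mkPoint] at h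
    nlinarith
  · have := hval i
    fin_cases j <;> simp [objective, vtxPoint, mkFunctional_mkPoint] at h <;> linarith
  · have := arcParam_gt j
    have := arcParam_le_one j
    have := hval i
    simp [objective, vtxPoint, mkFunctional_mkPoint] at h
    nlinarith
  · simp [objective, vtxPoint, mkFunctional_mkPoint] at h
    rw [Fin.ext h]

theorem isMinVtx_vtxPoint (k m : ℕ) :
    IsMinVtx (sensitivePolytope k m) (objective m) (vtxPoint k m (Sum.inl 0)) := by
  have hm : (0 : ℝ) ≤ m := Nat.cast_nonneg m
  refine ⟨vtxPoint_mem_vtx k m _, ?_⟩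
  rw [vtx_sensitivePolytope]
  rintro _ ⟨i | i | i, rfl⟩ h
  · fin_cases i <;> first
      | exact absurd rfl h
      | (simp [objective, vtxPoint, mkFunctional_mkPoint]; try linarith)
  · have := arcParam_gt i
    simp [objective, vtxPoint, mkFunctional_mkPoint]
    nlinarith
  · simp [objective, vtxPoint, mkFunctional_mkPoint]
    positivity

theorem isSecondMinVtx_vtxPoint (k m : ℕ) :
    IsSecondMinVtx (sensitivePolytope k m) (objective m) (vtxPoint k m (Sum.inl 0))
      (vtxPoint k m (Sum.inl 1)) := by
  have hm : (0 : ℝ) ≤ m := Nat.cast_nonneg m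
  refine ⟨vtxPoint_mem_vtx k m _, (vtxPoint_injective k m).ne (by simp), ?_⟩
  rw [vtx_sensitivePolytope]
  rintro _ ⟨i | i | i, rfl⟩ h h'
  · fin_cases i <;> first
      | exact absurd rfl h
      | exact absurd rfl h'
      | (simp [objective, vtxPoint, mkFunctional_mkPoint]; try linarith)
  · have := arcParam_gt i
    simp [objective, vtxPoint, mkFunctional_mkPoint]
    nlinarith
  · have : (0 : ℝ) ≤ (i : ℕ) := Nat.cast_nonneg _
    simp [objective, vtxPoint, mkFunctional_mkPoint]
    linarith

theorem isMaxVtx_vtxPoint (k m : ℕ) :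
    IsMaxVtx (sensitivePolytope k m) (objective m) (vtxPoint k m (Sum.inl 4)) := by
  have hm : (0 : ℝ) ≤ m := Nat.cast_nonneg m
  refine ⟨vtxPoint_mem_vtx k m _, ?_⟩
  rw [vtx_sensitivePolytope]
  rintro _ ⟨i | i | i, rfl⟩ h
  · fin_cases i <;> first
      | exact absurd rfl h
      | (simp [objective, vtxPoint, mkFunctional_mkPoint]; try linarith)
  · have := arcParam_gt i
    have := arcParam_le_one i
    simp [objective, vtxPoint, mkFunctional_mkPoint]
    nlinarith
  · have : ((i : ℕ) : ℝ) ≤ m := by exact_mod_cast i.2.le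
    simp [objective, vtxPoint, mkFunctional_mkPoint]
    linarith

theorem polyAdj_lowest_vtxPoint (k m : ℕ) :
    PolyAdj (sensitivePolytope k m) (vtxPoint k m (Sum.inl 0)) (vtxPoint k m (Sum.inl 1)) := by
  refine ⟨(vtxPoint_injective k m).ne (by simp), vtxPoint_mem_vtx k m _, vtxPoint_mem_vtx k m _,
    isExtreme_convexHull_of_supporting (mkFunctional (-1) (-1) 0 (-1)) 0 (convex_segment _ _)
      ((convex_convexHull ℝ _).segment_subset (vtxPoint_mem k m _) (vtxPoint_mem k m _)) ?_ ?_⟩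
  · rintro _ ⟨a, b, -, -, -, rfl⟩
    simp [vtxPoint, mkFunctional_mkPoint]
  · rintro _ ⟨i | i | i, rfl⟩
    · fin_cases i
      · exact Or.inl (left_mem_segment ℝ _ _)
      · exact Or.inl (right_mem_segment ℝ _ _)
      all_goals right; simp [vtxPoint, mkFunctional_mkPoint]
    · have := arcParam_gt i
      right
      simp [vtxPoint, mkFunctional_mkPoint]
      linarith
    · right
      simp [vtxPoint, mkFunctional_mkPoint]

/-- Two vertices are not adjacent if their segment crosses the segment of two other vertices. -/
theorem not_polyAdj_of_relation {k m : ℕ} {u v q r : VtxLabel k m} (hqu : u ≠ q) (hqv : v ≠ q)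
    {a b a' b' : ℝ} (ha : 0 < a) (hb : 0 < b) (ha' : 0 < a') (hb' : 0 < b')
    (hsum : a + b = a' + b')
    (h : a • vtxPoint k m u + b • vtxPoint k m v = a' • vtxPoint k m q + b' • vtxPoint k m r) :
    ¬ PolyAdj (sensitivePolytope k m) (vtxPoint k m u) (vtxPoint k m v) := fun hadj =>
  not_isExtreme_segment_of_relation (vtxPoint_mem_vtx k m q) (vtxPoint_mem k m r)
    (vtxPoint_mem k m u) (vtxPoint_mem k m v) ((vtxPoint_injective k m).ne hqu)
    ((vtxPoint_injective k m).ne hqv) ha hb ha' hb' hsum h hadj.2.2.2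

theorem not_polyAdj_second_top (k m : ℕ) :
    ¬ PolyAdj (sensitivePolytope k m) (vtxPoint k m (Sum.inl 1)) (vtxPoint k m (Sum.inl 4)) := by
  refine not_polyAdj_of_relation (q := Sum.inl 3) (r := Sum.inl 0) (a := 2) (b := 1) (a' := 2)
    (b' := 1) (by simp) (by simp) (by norm_num) (by norm_num) (by norm_num) (by norm_num) rfl ?_
  change _ • mkPoint 0 0 1 0 + _ • mkPoint 0 1 0 0 =
    _ • mkPoint 0 (1 / 2) 1 0 + _ • mkPoint 0 0 0 0
  simp only [smul_mkPoint_add_smul_mkPoint]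
  norm_num

theorem not_polyAdj_third_top (k m : ℕ) :
    ¬ PolyAdj (sensitivePolytope k m) (vtxPoint k m (Sum.inl 2)) (vtxPoint k m (Sum.inl 4)) := by
  refine not_polyAdj_of_relation (q := Sum.inl 3) (r := Sum.inr (Sum.inl 0)) (a := 2) (b := 1)
    (a' := 2) (b' := 1) (by simp) (by simp) (by norm_num) (by norm_num) (by norm_num)
    (by norm_num) rfl ?_
  change _ • mkPoint (1 / 2) 0 1 0 + _ • mkPoint 0 1 0 0 =
    _ • mkPoint 0 (1 / 2) 1 0 + _ • mkPoint (arcParam 0) 0 (arcParam 0 ^ 2 - arcParam 0) 0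
  simp only [smul_mkPoint_add_smul_mkPoint, arcParam_zero]
  norm_num

theorem not_polyAdj_second_arc (k m : ℕ) (i : Fin (k + 1)) :
    ¬ PolyAdj (sensitivePolytope k m) (vtxPoint k m (Sum.inl 1))
      (vtxPoint k m (Sum.inr (Sum.inl i))) := by
  have h1 := arcParam_gt i
  have h2 := arcParam_le_one i
  refine not_polyAdj_of_relation (q := Sum.inl 2) (r := Sum.inl 0)
    (a := 3 * arcParam i - arcParam i ^ 2) (b := 1) (a' := 2 * arcParam i)
    (b' := 1 + arcParam i - arcParam i ^ 2) (by simp) (by simp) (by nlinarith) (by norm_num)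
    (by linarith) (by nlinarith) (by ring) ?_
  change _ • mkPoint 0 0 1 0 + _ • mkPoint (arcParam i) 0 (arcParam i ^ 2 - arcParam i) 0 =
    _ • mkPoint (1 / 2) 0 1 0 + _ • mkPoint 0 0 0 0
  simp only [smul_mkPoint_add_smul_mkPoint]
  congr 1 <;> ring_nf

theorem not_hkPaths_sensitivePolytope (k m : ℕ) :
    ¬ HKPaths (ReverseEdge (LPDigraph (sensitivePolytope k m) (objective m))
      (vtxPoint k m (Sum.inl 0)) (vtxPoint k m (Sum.inl 1)))
      (vtxPoint k m (Sum.inl 1)) (vtxPoint k m (Sum.inl 4)) (m + 3) := by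
  have hinj := vtxPoint_injective k m
  have hcut : ∀ i (j : Fin 5), j ≠ 0 → j ≠ 3 →
      (Fin.cons (Sum.inl 0) (Fin.cons (Sum.inl 3) fun j => Sum.inr (Sum.inr j)) :
        Fin (m + 2) → VtxLabel k m) i ≠ Sum.inl j := by
    intro i j h0 h3
    refine Fin.cases ?_ (fun i => Fin.cases ?_ (fun i => ?_) i) i
    · simpa using h0.symm
    · simpa using h3.symm
    · simp
  refine not_hkPaths_of_cut (A := {vtxPoint k m (Sum.inl 1), vtxPoint k m (Sum.inl 2)})
    (fun i => vtxPoint k m ((Fin.cons (Sum.inl 0) (Fin.cons (Sum.inl 3)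
      fun j => Sum.inr (Sum.inr j)) : Fin (m + 2) → VtxLabel k m) i))
    (by simp) ?_ (fun i => hinj.ne (hcut i 1 (by decide) (by decide)))
    (fun i => hinj.ne (hcut i 4 (by decide) (by decide))) ?_
  · rintro (h | h)
    · exact absurd (hinj h) (by simp)
    · exact absurd (hinj h) (by simp)
  · rintro u v hu (⟨⟨hadj, hlt⟩, -⟩ | ⟨-, rfl⟩)
    swap
    · exact Or.inr ⟨0, rfl⟩
    have hv := hadj.2.2.1
    rw [vtx_sensitivePolytope] at hv
    obtain ⟨i | i | i, rfl⟩ := hv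
    · fin_cases i
      · exact Or.inr ⟨0, rfl⟩
      · exact Or.inl (Or.inl rfl)
      · exact Or.inl (Or.inr rfl)
      · exact Or.inr ⟨1, rfl⟩
      · rcases hu with rfl | rfl
        · exact absurd hadj (not_polyAdj_second_top k m)
        · exact absurd hadj (not_polyAdj_third_top k m)
    · rcases hu with rfl | rfl
      · exact absurd hadj (not_polyAdj_second_arc k m i)
      · have := arcParam_gt i
        have := arcParam_le_one i
        simp [objective, vtxPoint, mkFunctional_mkPoint] at hlt
        nlinarith
    · exact Or.inr ⟨i.succ.succ, rfl⟩

theorem sensitiveMarkedLP_sensitivePolytope (k m : ℕ) :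
    SensitiveMarkedLP (m + 3) (sensitivePolytope k m) (objective m)
      (vtxPoint k m (Sum.inl 0)) (vtxPoint k m (Sum.inl 1)) := by
  refine ⟨?_, isMinVtx_vtxPoint k m, isSecondMinVtx_vtxPoint k m, polyAdj_lowest_vtxPoint k m,
    not_satisfiesHK_reverseEdge (isSecondMinVtx_vtxPoint k m) (isMaxVtx_vtxPoint k m)
      ((vtxPoint_injective k m).ne (by simp)) (not_hkPaths_sensitivePolytope k m)⟩
  rw [GenericOn, vtx_sensitivePolytope]
  rintro _ ⟨i, rfl⟩ _ ⟨j, rfl⟩ h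
  rw [objective_vtxPoint_injective k m h]

theorem isPolytope_sensitivePolytope (k m : ℕ) : IsPolytope (m + 3) (sensitivePolytope k m) :=
  ⟨(finite_range (vtxPoint k m)).toFinset, by simp [sensitivePolytope],
    by simpa using affineSpan_range_vtxPoint k m⟩

theorem ncard_vtx_sensitivePolytope (k m : ℕ) :
    (Vtx (sensitivePolytope k m)).ncard = m + k + 6 := by
  rw [vtx_sensitivePolytope, ← Nat.card_coe_set_eq,
    Nat.card_range_of_injective (vtxPoint_injective k m)]
  simp only [Nat.card_eq_fintype_card, Fintype.card_sum, Fintype.card_fin]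
  omega

end Construction

/-- For each `d ≥ 3` and each `n ≥ d + 3`, there exists a
`d`-polytope in `ℝ^d` with exactly `n` vertices whose graph admits a sensitive
LP digraph. -/
theorem exists_dpolytope_sensitiveLP (d n : ℕ) (hd : 3 ≤ d) (hn : d + 3 ≤ n) :
    ∃ P : Set (Euc d),
      IsPolytope d P ∧ (Vtx P).ncard = n ∧ AdmitsSensitiveLP d P := by
  obtain ⟨m, rfl⟩ := Nat.exists_eq_add_of_le' hd
  obtain ⟨k, rfl⟩ := Nat.exists_eq_add_of_le hn
  exact ⟨sensitivePolytope k m, isPolytope_sensitivePolytope k m,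
    (ncard_vtx_sensitivePolytope k m).trans (by omega), objective m, _, _,
    sensitiveMarkedLP_sensitivePolytope k m⟩
end

section
/- There exists a 3-polytope in ℝ^3 with exactly 6 vertices whose graph admits a sensitive LP digraph. -/
open Set

/-- A convex set in a hyperplane `g = M` together with the open halfspace `g < M` is convex. -/
lemma convex_halfSpace_lt_union {d : ℕ} (g : Euc d →ₗ[ℝ] ℝ) (M : ℝ) {K : Set (Euc d)}
    (hK : Convex ℝ K) (hKM : ∀ x ∈ K, g x = M) : Convex ℝ ({x | g x < M} ∪ K) := by
  have hle : ∀ x ∈ {x | g x < M} ∪ K, g x ≤ M := by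
    rintro x (hx | hx)
    · exact le_of_lt hx
    · exact (hKM x hx).le
  rw [convex_iff_forall_pos]
  intro x hx y hy a b ha hb hab
  have hx' := hle x hx
  have hy' := hle y hy
  rcases hx with hx | hx
  · left
    rw [mem_ofPred_eq] at hx ⊢
    rw [map_add, map_smul, map_smul, smul_eq_mul, smul_eq_mul]
    have := mul_lt_mul_of_pos_left hx ha
    have := mul_le_mul_of_nonneg_left hy' hb.le
    have : a * M + b * M = M := by rw [← add_mul, hab, one_mul]
    linarith
  · rcases hy with hy | hy
    · left
      rw [mem_ofPred_eq] at hy ⊢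
      rw [map_add, map_smul, map_smul, smul_eq_mul, smul_eq_mul]
      have := mul_le_mul_of_nonneg_left hx' ha.le
      have := mul_lt_mul_of_pos_left hy hb
      have : a * M + b * M = M := by rw [← add_mul, hab, one_mul]
      linarith
    · exact Or.inr (hK hx hy ha.le hb.le hab)

/-- A convex subset `K` of a supporting hyperplane `g = M` of `convexHull S` that contains all points
of `S` on that hyperplane is an extreme subset. -/
lemma isExtreme_convexHull_of_support {d : ℕ} (g : Euc d →ₗ[ℝ] ℝ) (M : ℝ) {S K : Set (Euc d)}
    (hK : Convex ℝ K) (hKM : ∀ x ∈ K, g x = M) (hKS : K ⊆ convexHull ℝ S)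
    (hS : ∀ x ∈ S, g x < M ∨ x ∈ K) : IsExtreme ℝ (convexHull ℝ S) K := by
  have hsub : convexHull ℝ S ⊆ {x | g x < M} ∪ K :=
    convexHull_min hS (convex_halfSpace_lt_union g M hK hKM)
  refine ⟨hKS, ?_⟩
  intro x hx y hy z hz hzxy
  obtain ⟨a, b, ha, hb, hab, rfl⟩ := hzxy
  have hM := hKM _ hz
  simp only [map_add, map_smul, smul_eq_mul] at hM
  have hy' : g y ≤ M := by
    rcases hsub hy with h | h
    · exact le_of_lt h
    · exact (hKM y h).le
  rcases hsub hx with h | h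
  · rw [mem_ofPred_eq] at h
    have := mul_lt_mul_of_pos_left h ha
    have := mul_le_mul_of_nonneg_left hy' hb.le
    have : a * M + b * M = M := by rw [← add_mul, hab, one_mul]
    linarith
  · exact h

/-- A point of `S` that is the unique maximiser of a linear functional on `S` is an extreme point of
the convex hull. -/
lemma mem_vtx_convexHull_of_support {d : ℕ} (g : Euc d →ₗ[ℝ] ℝ) {S : Set (Euc d)} {v : Euc d}
    (hv : v ∈ S) (hS : ∀ x ∈ S, g x < g v ∨ x = v) : v ∈ Vtx (convexHull ℝ S) := by
  rw [Vtx, ← isExtreme_singleton]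
  refine isExtreme_convexHull_of_support g (g v) (convex_singleton v) ?_ ?_ hS
  · rintro x rfl
    rfl
  · rintro x rfl
    exact subset_convexHull ℝ S hv

/-- If the segment `[u, v]` meets the open segment between a third vertex `p` and a point `q` of `P`,
then `u` and `v` are not adjacent. -/
lemma not_polyAdj_of_crossing {d : ℕ} {P : Set (Euc d)} {u v p q m : Euc d}
    (hp : p ∈ Vtx P) (hq : q ∈ P) (hpu : p ≠ u) (hpv : p ≠ v)
    (hm : m ∈ segment ℝ u v) (hm' : m ∈ openSegment ℝ p q) : ¬ PolyAdj P u v := by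
  rintro ⟨-, hu, hv, hext⟩
  have h : p ∈ segment ℝ u v := hext.2 hp.1 hq hm hm'
  rcases (mem_extremePoints_iff_forall_segment.1 hp).2 u hu.1 v hv.1 h with h | h
  · exact hpu h.symm
  · exact hpv h.symm

/-- A chain that starts in `A` and avoids `C`, where every edge leaving `A` ends in `C`, stays in
`A`. -/
lemma chain_subset_of_avoids {α : Type*} {D : α → α → Prop} {A C : Set α}
    (hD : ∀ u ∈ A, ∀ v, D u v → v ∈ A ∨ v ∈ C) :
    ∀ (p : List α) (u : α), u ∈ A → (u :: p).IsChain D → (∀ x ∈ p, x ∉ C) →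
      ∀ x ∈ u :: p, x ∈ A
  | [], u, hu, _, _ => by simpa using hu
  | v :: p, u, hu, hc, hC => by
    rw [List.isChain_cons_cons] at hc
    have hv : v ∈ A := (hD u hu v hc.1).resolve_right (hC v (by simp))
    have ih := chain_subset_of_avoids hD p v hv hc.2 fun x hx => hC x (by simp [hx])
    intro x hx
    rcases List.mem_cons.1 hx with rfl | hx
    · exact hu
    · exact ih x hx

/-- A directed path from `A` to a point outside `A` meets every set `C` that contains the endpoints
of all edges leaving `A`. -/
lemma IsDipath.exists_mem_cut {α : Type*} {D : α → α → Prop} {A C : Set α} {s t : α} {p : List α}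
    (hp : IsDipath D s t p) (hD : ∀ u ∈ A, ∀ v, D u v → v ∈ A ∨ v ∈ C)
    (hs : s ∈ A) (ht : t ∉ A) : ∃ x ∈ p, x ∈ C := by
  obtain ⟨hc, hh, hl, -⟩ := hp
  by_contra! hC
  cases p with
  | nil => simp at hh
  | cons u p =>
    obtain rfl : u = s := by simpa using hh
    exact ht (chain_subset_of_avoids hD p u hs hc (fun x hx => hC x (by simp [hx])) t
      (List.mem_of_getLast? hl))

/-- Two vertices that cut `s` from `t` rule out three internally disjoint paths. -/
lemma not_hkPaths_three_of_cut {α : Type*} {D : α → α → Prop} {A : Set α} {s t x y : α}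
    (hD : ∀ u ∈ A, ∀ v, D u v → v ∈ A ∨ v ∈ ({x, y} : Set α))
    (hs : s ∈ A) (ht : t ∉ A) (hxs : x ≠ s) (hxt : x ≠ t) (hys : y ≠ s) (hyt : y ≠ t) :
    ¬ HKPaths D s t 3 := by
  rintro ⟨paths, hpath, hdisj⟩
  have hmeet : ∀ i, x ∈ paths i ∨ y ∈ paths i := fun i => by
    obtain ⟨z, hz, rfl | rfl⟩ := (hpath i).exists_mem_cut hD hs ht
    · exact Or.inl hz
    · exact Or.inr hz
  have hx : ∀ i j, i ≠ j → x ∈ paths i → x ∉ paths j := fun i j hij hi hj =>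
    (hdisj i j hij x hi hj).elim hxs hxt
  have hy : ∀ i j, i ≠ j → y ∈ paths i → y ∉ paths j := fun i j hij hi hj =>
    (hdisj i j hij y hi hj).elim hys hyt
  have h01 : (0 : Fin 3) ≠ 1 := by decide
  have h02 : (0 : Fin 3) ≠ 2 := by decide
  have h12 : (1 : Fin 3) ≠ 2 := by decide
  have := hmeet 0
  have := hmeet 1
  have := hmeet 2
  have := hx 0 1 h01
  have := hx 0 2 h02
  have := hx 1 2 h12
  have := hy 0 1 h01
  have := hy 0 2 h02
  have := hy 1 2 h12
  tauto

/-- The linear functional on `ℝ^3` with coefficients `a, b, c`. -/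
noncomputable def functional (a b c : ℝ) : Euc 3 →ₗ[ℝ] ℝ :=
  a • LinearMap.proj 0 + b • LinearMap.proj 1 + c • LinearMap.proj 2

@[simp]
lemma functional_vec (a b c x y z : ℝ) :
    functional a b c ![x, y, z] = a * x + b * y + c * z := by
  simp [functional]

/-- The vertices of a triangular frustum: the truncation of the cone over the basis vectors. -/
def frustumVertices : Set (Euc 3) :=
  {![2, 0, 0], ![1, 0, 0], ![0, 2, 0], ![0, 1, 0], ![0, 0, 1], ![0, 0, 2]}

lemma forall_mem_frustumVertices {p : Euc 3 → Prop} :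
    (∀ x ∈ frustumVertices, p x) ↔ p ![2, 0, 0] ∧ p ![1, 0, 0] ∧ p ![0, 2, 0] ∧ p ![0, 1, 0] ∧
      p ![0, 0, 1] ∧ p ![0, 0, 2] := by
  simp [frustumVertices]

lemma vtx_frustum : Vtx (convexHull ℝ frustumVertices) = frustumVertices := by
  refine Subset.antisymm extremePoints_convexHull_subset ?_
  change ∀ x ∈ frustumVertices, x ∈ Vtx (convexHull ℝ frustumVertices)
  rw [forall_mem_frustumVertices]
  refine ⟨mem_vtx_convexHull_of_support (functional 1 0 0) ?_ ?_,
    mem_vtx_convexHull_of_support (functional (-1) (-2) (-2)) ?_ ?_,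
    mem_vtx_convexHull_of_support (functional 0 1 0) ?_ ?_,
    mem_vtx_convexHull_of_support (functional (-2) (-1) (-2)) ?_ ?_,
    mem_vtx_convexHull_of_support (functional (-2) (-2) (-1)) ?_ ?_,
    mem_vtx_convexHull_of_support (functional 0 0 1) ?_ ?_⟩
  all_goals first
    | rw [forall_mem_frustumVertices]; norm_num
    | simp [frustumVertices]

lemma affineSpan_frustumVertices : affineSpan ℝ frustumVertices = ⊤ := by
  rw [AffineSubspace.affineSpan_eq_top_iff_vectorSpan_eq_top_of_nonempty ℝ _ _
    ⟨![2, 0, 0], by simp [frustumVertices]⟩, eq_top_iff]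
  intro x _
  have h0 := vsub_mem_vectorSpan ℝ (s := frustumVertices) (p₁ := ![2, 0, 0]) (p₂ := ![1, 0, 0])
    (by simp [frustumVertices]) (by simp [frustumVertices])
  have h1 := vsub_mem_vectorSpan ℝ (s := frustumVertices) (p₁ := ![0, 2, 0]) (p₂ := ![0, 1, 0])
    (by simp [frustumVertices]) (by simp [frustumVertices])
  have h2 := vsub_mem_vectorSpan ℝ (s := frustumVertices) (p₁ := ![0, 0, 2]) (p₂ := ![0, 0, 1])
    (by simp [frustumVertices]) (by simp [frustumVertices])
  convert Submodule.add_mem _ (Submodule.add_mem _ (Submodule.smul_mem _ (x 0) h0)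
    (Submodule.smul_mem _ (x 1) h1)) (Submodule.smul_mem _ (x 2) h2) using 1
  ext i
  fin_cases i <;> norm_num
  rfl

lemma isPolytope_frustum : IsPolytope 3 (convexHull ℝ frustumVertices) := by
  have hfin : frustumVertices.Finite := by simp [frustumVertices]
  exact ⟨hfin.toFinset, by simp, by simpa using affineSpan_frustumVertices⟩

lemma ncard_frustumVertices : frustumVertices.ncard = 6 := by
  classical
  have h : frustumVertices = (({![2, 0, 0], ![1, 0, 0], ![0, 2, 0], ![0, 1, 0], ![0, 0, 1],
      ![0, 0, 2]} : Finset (Euc 3)) : Set (Euc 3)) := by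
    simp [frustumVertices]
  rw [h, Set.ncard_coe_finset]
  norm_num [Finset.card_insert_of_notMem, funext_iff, Fin.forall_fin_succ]

lemma polyAdj_frustum :
    PolyAdj (convexHull ℝ frustumVertices) ![2, 0, 0] ![1, 0, 0] := by
  have hs : (![2, 0, 0] : Euc 3) ∈ frustumVertices := by simp [frustumVertices]
  have hw : (![1, 0, 0] : Euc 3) ∈ frustumVertices := by simp [frustumVertices]
  refine ⟨by norm_num, by rwa [vtx_frustum], by rwa [vtx_frustum], ?_⟩
  refine isExtreme_convexHull_of_support (functional 0 (-1) (-1)) 0 (convex_segment _ _) ?_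
    (segment_subset_convexHull hs hw) ?_
  · rintro x ⟨a, b, -, -, -, rfl⟩
    simp only [map_add, map_smul, functional_vec]
    norm_num
  · rw [forall_mem_frustumVertices]
    norm_num [left_mem_segment, right_mem_segment]

/-- The diagonal of a lateral face of the frustum is not an edge. -/
lemma not_polyAdj_frustum_diagonal {u v p q : Euc 3} (hp : p ∈ frustumVertices)
    (hq : q ∈ frustumVertices) (hpu : p ≠ u) (hpv : p ≠ v)
    (h : (2 / 3 : ℝ) • u + (1 / 3 : ℝ) • v = (1 / 3 : ℝ) • p + (2 / 3 : ℝ) • q) :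
    ¬ PolyAdj (convexHull ℝ frustumVertices) u v :=
  not_polyAdj_of_crossing (by rwa [vtx_frustum]) (subset_convexHull ℝ _ hq) hpu hpv
    ⟨2 / 3, 1 / 3, by norm_num, by norm_num, by norm_num, h⟩
    ⟨1 / 3, 2 / 3, by norm_num, by norm_num, by norm_num, rfl⟩

lemma not_hkPaths_frustum :
    ¬ HKPaths (ReverseEdge (LPDigraph (convexHull ℝ frustumVertices) (functional (-3) (-1) 1))
      ![2, 0, 0] ![1, 0, 0]) ![1, 0, 0] ![0, 0, 2] 3 := by
  have hwc : ¬ PolyAdj (convexHull ℝ frustumVertices) ![1, 0, 0] ![0, 2, 0] :=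
    not_polyAdj_frustum_diagonal (p := ![2, 0, 0]) (q := ![0, 1, 0]) (by simp [frustumVertices])
      (by simp [frustumVertices]) (by norm_num) (by norm_num) (by norm_num)
  have hwt : ¬ PolyAdj (convexHull ℝ frustumVertices) ![1, 0, 0] ![0, 0, 2] :=
    not_polyAdj_frustum_diagonal (p := ![2, 0, 0]) (q := ![0, 0, 1]) (by simp [frustumVertices])
      (by simp [frustumVertices]) (by norm_num) (by norm_num) (by norm_num)
  have hbt : ¬ PolyAdj (convexHull ℝ frustumVertices) ![0, 1, 0] ![0, 0, 2] :=
    not_polyAdj_frustum_diagonal (p := ![0, 2, 0]) (q := ![0, 0, 1]) (by simp [frustumVertices])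
      (by simp [frustumVertices]) (by norm_num) (by norm_num) (by norm_num)
  refine not_hkPaths_three_of_cut (A := {![1, 0, 0], ![0, 1, 0]}) (x := ![2, 0, 0])
    (y := ![0, 0, 1]) ?_ (by simp) (by norm_num) (by norm_num) (by norm_num)
    (by norm_num) (by norm_num)
  rintro u hu v (⟨⟨hadj, hlt⟩, -⟩ | ⟨-, rfl⟩)
  · have hv : v ∈ frustumVertices := vtx_frustum ▸ hadj.2.2.1
    revert hadj hlt
    revert v
    rw [forall_mem_frustumVertices]
    rcases hu with rfl | rfl
    · simp [hwc, hwt]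
    · norm_num [hbt]
  · simp

lemma sensitiveMarkedLP_frustum :
    SensitiveMarkedLP 3 (convexHull ℝ frustumVertices) (functional (-3) (-1) 1)
      ![2, 0, 0] ![1, 0, 0] := by
  have hw : (![1, 0, 0] : Euc 3) ∈ frustumVertices := by simp [frustumVertices]
  have ht : (![0, 0, 2] : Euc 3) ∈ frustumVertices := by simp [frustumVertices]
  have hmin : ∀ x ∈ frustumVertices, x ≠ ![2, 0, 0] → x ≠ ![1, 0, 0] →
      functional (-3) (-1) 1 ![1, 0, 0] < functional (-3) (-1) 1 x := by
    rw [forall_mem_frustumVertices]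
    norm_num
  have hmax : ∀ x ∈ frustumVertices,
      functional (-3) (-1) 1 x ≤ functional (-3) (-1) 1 ![0, 0, 2] := by
    rw [forall_mem_frustumVertices]
    norm_num
  refine ⟨?_, ⟨?_, ?_⟩, ⟨?_, by norm_num, ?_⟩, polyAdj_frustum, ?_⟩
  · rw [GenericOn, vtx_frustum, InjOn]
    simp only [forall_mem_frustumVertices]
    norm_num
  · rw [vtx_frustum]
    simp [frustumVertices]
  · rw [vtx_frustum, forall_mem_frustumVertices]
    norm_num
  · rwa [vtx_frustum]
  · rwa [vtx_frustum]
  · rintro ⟨s, t, ⟨-, hs⟩, ⟨-, ht'⟩, hpaths⟩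
    have hsw : ![1, 0, 0] = s := by
      refine hs _ ⟨by rwa [vtx_frustum], ?_⟩
      rintro x hx (⟨⟨hadj, hlt⟩, hne⟩ | ⟨-, h⟩)
      · rw [vtx_frustum] at hx
        exact absurd (hmin x hx (fun h => hne ⟨h, rfl⟩) hadj.1) hlt.not_gt
      · norm_num at h
    have htt : ![0, 0, 2] = t := by
      refine ht' _ ⟨by rwa [vtx_frustum], ?_⟩
      rintro x hx (⟨⟨-, hlt⟩, -⟩ | ⟨h, -⟩)
      · rw [vtx_frustum] at hx
        exact absurd hlt (hmax x hx).not_gt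
      · norm_num at h
    rw [← hsw, ← htt] at hpaths
    exact not_hkPaths_frustum hpaths

/-- There exists a 3-polytope in `ℝ^3` with exactly `6`
vertices whose graph admits a sensitive LP digraph. -/
theorem exists_3polytope_six_vertices_sensitiveLP :
    ∃ P : Set (Euc 3),
      IsPolytope 3 P ∧ (Vtx P).ncard = 6 ∧ AdmitsSensitiveLP 3 P := by
  refine ⟨convexHull ℝ frustumVertices, isPolytope_frustum, ?_, _, _, _,
    sensitiveMarkedLP_frustum⟩
  rw [vtx_frustum, ncard_frustumVertices]
end

section
/- Let G be a finite simple graph and f : V(G) → ℝ an injective function; orient every edge of G from its endpoint with smaller f-value to its endpoint with larger f-value. Suppose s is the vertex with the minimum f-value, w is the vertex with the second smallest f-value, and {s,w} is an edge of G. Then the digraph obtained from this orientation by reversing the single edge (s,w) (so that it is directed from w to s) is acyclic. -/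
open Set

/-- A digraph along whose edges a real-valued potential strictly increases is acyclic. -/
theorem DigraphAcyclic.of_lt {α : Type*} {D : α → α → Prop} (g : α → ℝ)
    (hg : ∀ u v, D u v → g u < g v) : DigraphAcyclic D := by
  intro x hx
  have h := hx.lift g hg
  rw [Relation.transGen_eq_self] at h
  exact lt_irrefl _ h

/-- Let `G` be a finite simple graph and `f : V(G) → ℝ`
injective; orient every edge of `G` from its endpoint with smaller `f`-value to
its endpoint with larger `f`-value. Suppose `s` is the vertex with the minimum
`f`-value, `w` is the vertex with the second smallest `f`-value, and `{s, w}`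
is an edge of `G`. Then the digraph obtained from this orientation by reversing
the single edge `(s, w)` (so that it is directed from `w` to `s`) is acyclic. -/
theorem reversed_min_edge_acyclic {V : Type*} [Fintype V]
    (G : SimpleGraph V) (f : V → ℝ) (hf : Function.Injective f)
    (s w : V)
    (hs : ∀ x, x ≠ s → f s < f x)
    (hw : w ≠ s) (hw2 : ∀ x, x ≠ s → x ≠ w → f w < f x)
    (hsw : G.Adj s w) :
    DigraphAcyclic (ReverseEdge (fun u v => G.Adj u v ∧ f u < f v) s w) := by
  classical
  -- Exchanging the values of `s` and `w` gives a potential for the new digraph.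
  refine DigraphAcyclic.of_lt (f ∘ Equiv.swap s w) ?_
  have hlt := hs w hw
  rintro u v (⟨⟨-, huv⟩, hne⟩ | ⟨rfl, rfl⟩)
  · have hvs : v ≠ s := by
      rintro rfl
      exact (hs u fun h => huv.ne (congrArg f h)).not_gt huv
    have hvw : v ≠ w := by
      rintro rfl
      have hus : u ≠ s := fun h => hne ⟨h, rfl⟩
      exact (hw2 u hus fun h => huv.ne (congrArg f h)).not_gt huv
    simp only [Function.comp_apply, Equiv.swap_apply_of_ne_of_ne hvs hvw]
    rw [Equiv.swap_apply_def]
    split_ifs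
    · exact hw2 v hvs hvw
    · exact hs v hvs
    · exact huv
  · simpa using hlt
end

section
/- Let P be a d-polytope in ℝ^d with d ≥ 2, let F_a and F_b be two adjacent facets of P (i.e., F_a ∩ F_b is a face of P of dimension d−2) with facet-supporting hyperplanes H_a and H_b, and let L be a line passing through the interior of P such that L meets H_a in a single point V_a, L meets H_b in a single point V_b, V_a ≠ V_b, and L does not meet H_a ∩ H_b. Then there exist d−1 points in the relative interior of F_a ∩ F_b such that these d−1 points together with V_a and V_b are affinely independent; that is, their convex hull is a d-simplex whose vertex set consists of V_a, V_b, and d−1 points in the relative interior of F_a ∩ F_b. -/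
open Set

/-- `F` is a (nonempty, convex) face of `P` of dimension `k`. -/
def IsFaceOfDim (d k : ℕ) (P F : Set (Euc d)) : Prop :=
  F.Nonempty ∧ Convex ℝ F ∧ IsExtreme ℝ P F ∧
  Module.finrank ℝ (affineSpan ℝ F).direction = k

/-- Adding a point outside the affine span preserves affine independence of a set. -/
theorem affineIndependent_insert_of_notMem_affineSpan {k V P : Type*} [DivisionRing k]
    [AddCommGroup V] [Module k V] [AddTorsor V P] {s : Set P} {p : P}
    (hs : AffineIndependent k ((↑) : s → P)) (hp : p ∉ affineSpan k s) :
    AffineIndependent k ((↑) : ↥(insert p s) → P) := by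
  refine AffineIndependent.affineIndependent_of_notMem_span (i := ⟨p, mem_insert p s⟩) ?_ ?_
  · let e : {y : ↥(insert p s) // y ≠ ⟨p, mem_insert p s⟩} ↪ s :=
      ⟨fun y => ⟨y.1.1, y.1.2.resolve_left fun h => y.2 (Subtype.ext h)⟩,
        fun y z h => by simpa [Subtype.ext_iff] using h⟩
    exact hs.comp_embedding e
  · refine fun h => hp (affineSpan_mono k ?_ h)
    rintro _ ⟨y, hy, rfl⟩
    exact y.2.resolve_left fun h => hy (Subtype.ext h)

/-- The intrinsic interior of a nonempty finite-dimensional convex set has the same affine span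
as the set. -/
theorem affineSpan_intrinsicInterior {V : Type*} [NormedAddCommGroup V] [NormedSpace ℝ V]
    [FiniteDimensional ℝ V] {s : Set V} (hs : Convex ℝ s) (hne : s.Nonempty) :
    affineSpan ℝ (intrinsicInterior ℝ s) = affineSpan ℝ s := by
  have : Nonempty (affineSpan ℝ s) := ((affineSpan_nonempty ℝ).2 hne).to_subtype
  have hint : (interior ((↑) ⁻¹' s : Set (affineSpan ℝ s))).Nonempty :=
    image_nonempty.1 (hne.intrinsicInterior hs)
  have h := AffineSubspace.map_span (affineSpan ℝ s).subtype
    (interior ((↑) ⁻¹' s : Set (affineSpan ℝ s)))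
  rw [isOpen_interior.affineSpan_eq_top hint] at h
  refine h.symm.trans ?_
  ext x
  simp

/-- A nonempty convex set of affine dimension `n` contains `n + 1` affinely independent points
in its intrinsic interior. -/
theorem exists_affineIndependent_mem_intrinsicInterior {V : Type*} [NormedAddCommGroup V]
    [NormedSpace ℝ V] [FiniteDimensional ℝ V] {s : Set V} (hs : Convex ℝ s) (hne : s.Nonempty)
    {n : ℕ} (hn : Module.finrank ℝ (affineSpan ℝ s).direction + 1 = n) :
    ∃ f : Fin n → V, (∀ i, f i ∈ intrinsicInterior ℝ s) ∧ AffineIndependent ℝ f := by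
  obtain ⟨t, hts, hspan, ht⟩ := exists_affineIndependent ℝ V (intrinsicInterior ℝ s)
  rw [affineSpan_intrinsicInterior hs hne] at hspan
  have : Nonempty t :=
    ((affineSpan_nonempty ℝ).1 (hspan ▸ (affineSpan_nonempty ℝ).2 hne)).to_subtype
  have : Fintype t := (finite_set_of_fin_dim_affineIndependent ℝ ht).fintype
  have hcard : Fintype.card t = n := by
    rw [← hn, ← ht.finrank_vectorSpan_add_one, Subtype.range_coe, ← hspan, direction_affineSpan]
  let e : Fin n ≃ t := (Fintype.equivFinOfCardEq hcard).symm
  exact ⟨fun i => e i, fun i => hts (e i).2, ht.comp_embedding e.toEmbedding⟩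

/-- A linear functional that is constant on a set is constant on its affine span. -/
theorem eq_of_mem_affineSpan_of_forall_eq {k V : Type*} [Ring k] [AddCommGroup V] [Module k V]
    {g : V →ₗ[k] k} {c : k} {s : Set V} (h : ∀ x ∈ s, g x = c) {x : V}
    (hx : x ∈ affineSpan k s) : g x = c := by
  refine affineSpan_induction hx h fun a u v w hu hv hw => ?_
  simp [hu, hv, hw]

/-- Let `P` be a `d`-polytope in `ℝ^d` with `d ≥ 2`, let
`F_a`, `F_b` be two adjacent facets of `P` (their intersection is a face of
dimension `d - 2`) with facet-supporting hyperplanes `H_a = {x | ga x = ca}`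
and `H_b = {x | gb x = cb}`, and let `L` be a line passing through the interior
of `P` meeting `H_a` in the single point `V_a`, meeting `H_b` in the single
point `V_b`, with `V_a ≠ V_b` and `L` disjoint from `H_a ∩ H_b`. Then there
exist `d - 1` points in the relative interior of `F_a ∩ F_b` which together
with `V_a` and `V_b` form `d + 1` affinely independent points, i.e. their
convex hull is a `d`-simplex with vertices `V_a`, `V_b` and `d - 1` points in
the relative interior of `F_a ∩ F_b`. -/
theorem simplex_on_adjacent_facets
    (d : ℕ) (hd : 2 ≤ d) (P Fa Fb : Set (Euc d))
    (ga gb : Euc d →ₗ[ℝ] ℝ) (ca cb : ℝ)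
    (p u : Euc d) (L : Set (Euc d)) (Va Vb : Euc d)
    (hP : IsPolytope d P)
    (hFa : IsFaceOfDim d (d - 1) P Fa)
    (hFb : IsFaceOfDim d (d - 1) P Fb)
    (hFab : IsFaceOfDim d (d - 2) P (Fa ∩ Fb))
    (hga : ga ≠ 0) (hgb : gb ≠ 0)
    (hFaH : Fa ⊆ {x : Euc d | ga x = ca})
    (hFbH : Fb ⊆ {x : Euc d | gb x = cb})
    (hu : u ≠ 0) (hL : L = {x : Euc d | ∃ t : ℝ, x = p + t • u})
    (hint : (L ∩ interior P).Nonempty)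
    (hVa : L ∩ {x : Euc d | ga x = ca} = {Va})
    (hVb : L ∩ {x : Euc d | gb x = cb} = {Vb})
    (hVab : Va ≠ Vb)
    (hdisj : L ∩ ({x : Euc d | ga x = ca} ∩ {x : Euc d | gb x = cb}) = ∅) :
    ∃ pts : Fin (d - 1) → Euc d,
      (∀ i, pts i ∈ intrinsicInterior ℝ (Fa ∩ Fb)) ∧
      Function.Injective pts ∧
      Va ∉ Set.range pts ∧ Vb ∉ Set.range pts ∧
      AffineIndependent ℝ
        (fun x : (insert Va (insert Vb (Set.range pts)) : Set (Euc d)) =>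
          (x : Euc d)) := by
  obtain ⟨hne, hconv, -, hdim⟩ := hFab
  obtain ⟨pts, hpts, hind⟩ :=
    exists_affineIndependent_mem_intrinsicInterior hconv hne (n := d - 1)
      ((congrArg (· + 1) hdim).trans (by omega))
  have hVaL : Va ∈ L ∩ {x | ga x = ca} := hVa ▸ mem_singleton Va
  have hVbL : Vb ∈ L ∩ {x | gb x = cb} := hVb ▸ mem_singleton Vb
  have hVa_gb : gb Va ≠ cb := fun h => (hdisj ▸ notMem_empty Va) ⟨hVaL.1, hVaL.2, h⟩
  have hVb_ga : ga Vb ≠ ca := fun h => (hdisj ▸ notMem_empty Vb) ⟨hVbL.1, h, hVbL.2⟩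
  have hpts_ga : ∀ x ∈ range pts, ga x = ca := by
    rintro _ ⟨i, rfl⟩
    exact hFaH (intrinsicInterior_subset (hpts i)).1
  have hpts_gb : ∀ x ∈ range pts, gb x = cb := by
    rintro _ ⟨i, rfl⟩
    exact hFbH (intrinsicInterior_subset (hpts i)).2
  refine ⟨pts, hpts, hind.injective, fun h => hVa_gb (hpts_gb _ h),
    fun h => hVb_ga (hpts_ga _ h), ?_⟩
  rw [insert_comm]
  refine affineIndependent_insert_of_notMem_affineSpan
    (affineIndependent_insert_of_notMem_affineSpan hind.range fun h =>
      hVa_gb (eq_of_mem_affineSpan_of_forall_eq hpts_gb h)) fun h =>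
    hVb_ga (eq_of_mem_affineSpan_of_forall_eq ?_ h)
  rintro x (rfl | hx)
  · exact hVaL.2
  · exact hpts_ga x hx
end
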